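/- Let α ∈ ℝ, N ≥ 2, λ > 0, let Ω := B_λ(0) ⊂ ℝ² be the open disk of radius λ centered at the origin, and let u be an N-anyon wave function. Then ∫_{Ω^N} ∑_{j=1}^N |D_j u|² dx ≥ (C_{α,N}²/(N λ²)) ∫_{Ω^N} ∑_{1≤i<j≤N} f((x_i+x_j)/(2λ), (x_i−x_j)/(2λ√(1−R²))) |u|² dx, where, identifying ℝ² with ℂ and writing 𝐑 := (x_i+x_j)/(2λ), R := |𝐑|, γ_R := 1 − (2/π)·arcsin(R), and letting z be the complex number obtained from the rescaled relative coordinate 𝐫̃ := (x_i−x_j)/(2λ√(1−R²)) by the rotation taking the unit vector 𝐑/R to the imaginary unit, i.e. z := i·(conj(𝐑)/R)·𝐫̃ when R > 0 and z := 𝐫̃ when R = 0, one defines f(𝐑,𝐫̃) := (16/(γ_R²(1−R²))) · |(1+z)^{1+1/γ_R}(1−z)^{1−1/γ_R} − (1−z)^{1+1/γ_R}(1+z)^{1−1/γ_R}|^{−2}, the complex powers being principal branches. -/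

import Mathlib

open MeasureTheory

noncomputable section

/-- Squared magnitude of the covariant derivative `D_j u` at configuration `x`;
the plane `ℝ²` is identified with `ℂ` (so `a^⊥ = I·a`, and the two components of a
vector field are the real and imaginary parts). -/
def covSq (α : ℝ) {N : ℕ} (u : (Fin N → ℂ) → ℂ) (j : Fin N) (x : Fin N → ℂ) : ℝ :=
  let A : ℂ := (α : ℂ) * ∑ k ∈ Finset.univ.erase j,
    Complex.I * (x j - x k) / ((‖x j - x k‖ : ℂ) ^ 2)
  ‖-Complex.I * fderiv ℝ u x (Pi.single j 1) + (A.re : ℂ) * u x‖ ^ 2 +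
    ‖-Complex.I * fderiv ℝ u x (Pi.single j Complex.I) + (A.im : ℂ) * u x‖ ^ 2

/-- The statistics constant `C_{α,N} = min_{p ∈ {0,…,N-2}} min_{q ∈ ℤ} |(2p+1)α - 2q|`. -/
def statC (α : ℝ) (N : ℕ) : ℝ :=
  ⨅ p : Fin (N - 1), ⨅ q : ℤ, |(2 * ((p : ℕ) : ℝ) + 1) * α - 2 * (q : ℝ)|

/-- `N`-anyon wave function in the magnetic gauge (smooth compactly supported
form-core representative): totally symmetric with support away from the diagonals. -/
structure IsAnyonWF (N : ℕ) (u : (Fin N → ℂ) → ℂ) : Prop where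
  smooth : ContDiff ℝ (⊤ : ℕ∞) u
  compactSupport : HasCompactSupport u
  symmetric : ∀ (σ : Equiv.Perm (Fin N)) (x : Fin N → ℂ), u (x ∘ σ) = u x
  offDiagonal : ∀ x ∈ tsupport u, ∀ j k : Fin N, j ≠ k → x j ≠ x k

/-- One-particle density of an `N`-particle wave function. -/
def density (N : ℕ) (u : (Fin N → ℂ) → ℂ) (y : ℂ) : ℝ :=
  ∑ j : Fin N, ∫ z : {k : Fin N // k ≠ j} → ℂ,
    ‖u (fun k => if h : k = j then y else z ⟨k, h⟩)‖ ^ 2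

/-- The conformal Hardy weight `f(𝐑, 𝐫̃)` of Theorem (many-anyon Hardy on a disk):
with `R = |𝐑|`, `γ_R = 1 - (2/π) arcsin R`, and `z` the rotation of `𝐫̃` taking `𝐑/R`
to the imaginary unit (for `R > 0`; `z = 𝐫̃` for `R = 0`),
`f = 16/(γ_R²(1-R²)) · |(1+z)^{1+1/γ_R}(1-z)^{1-1/γ_R} - (1-z)^{1+1/γ_R}(1+z)^{1-1/γ_R}|⁻²`,
with principal-branch complex powers. -/
def hardyF (R' r' : ℂ) : ℝ :=
  let R : ℝ := ‖R'‖
  let γ : ℝ := 1 - 2 / Real.pi * Real.arcsin R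
  let z : ℂ := if R = 0 then r' else Complex.I * (starRingEnd ℂ R' / (R : ℂ)) * r'
  16 / (γ ^ 2 * (1 - R ^ 2)) /
    ‖(1 + z) ^ ((1 + 1 / γ : ℝ) : ℂ) * (1 - z) ^ ((1 - 1 / γ : ℝ) : ℂ) -
      (1 - z) ^ ((1 + 1 / γ : ℝ) : ℂ) * (1 + z) ^ ((1 - 1 / γ : ℝ) : ℂ)‖ ^ 2

/-- Parseval bound for the shifted derivative of a periodic function. -/
lemma sq_mul_integral_le_of_shifted_deriv {s T κ c : ℝ} (hT : 0 < T) {h h' : ℝ → ℂ}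
    (hd : ∀ θ, HasDerivAt h (h' θ) θ) (hc' : Continuous h') (hper : h (s + T) = h s)
    (hc0 : 0 ≤ c) (hc : ∀ n : ℤ, c ≤ |2 * Real.pi / T * n + κ|) :
    c ^ 2 * ∫ θ in s..s + T, ‖h θ‖ ^ 2 ≤
      ∫ θ in s..s + T, ‖h' θ + Complex.I * κ * h θ‖ ^ 2 := by
  have hab : s < s + T := by linarith
  have hcont : Continuous h := continuous_iff_continuousAt.2 fun θ => (hd θ).continuousAt
  have hmem : ∀ g : ℝ → ℂ, Continuous g → MemLp g 2 (volume.restrict (Set.Ioc s (s + T))) :=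
    fun g hg => (memLp_two_iff_integrable_sq_norm hg.aestronglyMeasurable).2
      ((intervalIntegrable_iff_integrableOn_Ioc_of_le hab.le).1
        ((hg.norm.pow 2).intervalIntegrable _ _))
  set k : ℝ → ℂ := fun θ => h' θ + Complex.I * κ * h θ with hk
  have hkc : Continuous k := by fun_prop
  have H1 := hasSum_sq_fourierCoeffOn hab (hmem h hcont)
  have H2 := hasSum_sq_fourierCoeffOn hab (hmem k hkc)
  have hpi := Real.pi_pos
  have hTC : (T : ℂ) ≠ 0 := by exact_mod_cast hT.ne'
  have hcoeff' : ∀ n : ℤ, fourierCoeffOn hab h' n =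
      (2 * Real.pi / T * n * Complex.I) * fourierCoeffOn hab h n := by
    intro n
    rcases eq_or_ne n 0 with rfl | hn
    · rw [fourierCoeffOn_eq_integral]
      have : ∫ x in s..s + T, h' x = h (s + T) - h s :=
        intervalIntegral.integral_eq_sub_of_hasDerivAt (fun x _ => hd x)
          (hc'.intervalIntegrable _ _)
      simp [this, hper]
    · rw [fourierCoeffOn_of_hasDerivAt hab hn (fun x _ => hd x) (hc'.intervalIntegrable _ _), hper]
      have h1 : (n : ℂ) ≠ 0 := by exact_mod_cast hn
      have h2 : (Real.pi : ℂ) ≠ 0 := by exact_mod_cast hpi.ne'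
      push_cast
      field_simp
      ring
  have hcoeff : ∀ n : ℤ, fourierCoeffOn hab k n =
      (((2 * Real.pi / T * n + κ : ℝ) : ℂ) * Complex.I) * fourierCoeffOn hab h n := by
    intro n
    have e1 : fourierCoeffOn hab k n = fourierCoeffOn hab h' n +
        Complex.I * κ * fourierCoeffOn hab h n := by
      simp only [fourierCoeffOn_eq_integral, hk, smul_eq_mul, mul_add]
      rw [intervalIntegral.integral_add]
      · simp only [smul_add, Complex.real_smul]
        rw [mul_left_comm (Complex.I * (κ : ℂ)), ← intervalIntegral.integral_const_mul (Complex.I * (κ : ℂ))]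
        congr 2
        exact intervalIntegral.integral_congr fun x _ => mul_left_comm _ _ _
      · refine Continuous.intervalIntegrable ?_ _ _
        have : Continuous fun x : ℝ => (fourier (-n) : C(AddCircle (s + T - s), ℂ)) (x : AddCircle (s + T - s)) :=
          (fourier (-n)).continuous.comp (AddCircle.continuous_mk' _)
        fun_prop
      · refine Continuous.intervalIntegrable ?_ _ _
        have : Continuous fun x : ℝ => (fourier (-n) : C(AddCircle (s + T - s), ℂ)) (x : AddCircle (s + T - s)) :=
          (fourier (-n)).continuous.comp (AddCircle.continuous_mk' _)
        fun_prop
    rw [e1, hcoeff']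
    push_cast
    ring
  have hle := hasSum_le (fun n : ℤ => ?_) (H1.mul_left (c ^ 2)) H2
  · have hT' : 0 < (s + T - s)⁻¹ := by
      rw [add_sub_cancel_left]; positivity
    simp only [smul_eq_mul] at hle
    rw [mul_left_comm] at hle
    exact le_of_mul_le_mul_left hle hT'
  · rw [hcoeff, norm_mul, norm_mul, Complex.norm_I, mul_one, mul_pow, Complex.norm_real,
      Real.norm_eq_abs]
    have := hc n
    gcongr

/-- Lower bound for the covariant derivative of a periodic function along a loop carrying
total flux `κ T`. -/
lemma sq_mul_integral_le_of_flux {s T κ c : ℝ} (hT : 0 < T) {v v' : ℝ → ℂ} {a : ℝ → ℝ}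
    (hd : ∀ θ, HasDerivAt v (v' θ) θ) (hc' : Continuous v') (ha : Continuous a)
    (hper : v (s + T) = v s) (hflux : ∫ θ in s..s + T, a θ = κ * T)
    (hc0 : 0 ≤ c) (hc : ∀ n : ℤ, c ≤ |2 * Real.pi / T * n + κ|) :
    c ^ 2 * ∫ θ in s..s + T, ‖v θ‖ ^ 2 ≤
      ∫ θ in s..s + T, ‖v' θ + Complex.I * a θ * v θ‖ ^ 2 := by
  set b : ℝ → ℝ := fun θ => (∫ t in s..θ, a t) - κ * (θ - s) with hb
  have hbd : ∀ θ, HasDerivAt b (a θ - κ) θ := fun θ => by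
    have h1 := intervalIntegral.integral_hasDerivAt_right (ha.intervalIntegrable s θ)
      (ha.stronglyMeasurableAtFilter _ _) ha.continuousAt
    have h2 : HasDerivAt (fun θ : ℝ => κ * (θ - s)) κ θ := by
      simpa using ((hasDerivAt_id θ).sub_const s).const_mul κ
    exact h1.sub h2
  have hbc : Continuous b := continuous_iff_continuousAt.2 fun θ => (hbd θ).continuousAt
  have hvc : Continuous v := continuous_iff_continuousAt.2 fun θ => (hd θ).continuousAt
  set e : ℝ → ℂ := fun θ => Complex.exp (b θ * Complex.I) with he
  have hec : Continuous e := by fun_prop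
  have hed : ∀ θ, HasDerivAt e (e θ * ((a θ - κ : ℝ) * Complex.I)) θ := fun θ =>
    (((hbd θ).ofReal_comp).mul_const Complex.I).cexp
  have hen : ∀ θ, ‖e θ‖ = 1 := fun θ => Complex.norm_exp_ofReal_mul_I _
  have hbs : b s = 0 := by simp [hb]
  have hbT : b (s + T) = 0 := by simp [hb, hflux]
  have key := sq_mul_integral_le_of_shifted_deriv (s := s) (h := fun θ => e θ * v θ)
    (h' := fun θ => e θ * ((a θ - κ : ℝ) * Complex.I) * v θ + e θ * v' θ) (κ := κ) hT
    (fun θ => (hed θ).mul (hd θ)) (by fun_prop) (by simp [he, hbs, hbT, hper]) hc0 hc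
  have e1 : ∀ θ, ‖e θ * v θ‖ ^ 2 = ‖v θ‖ ^ 2 := fun θ => by rw [norm_mul, hen, one_mul]
  have e2 : ∀ θ, ‖e θ * ((a θ - κ : ℝ) * Complex.I) * v θ + e θ * v' θ +
      Complex.I * κ * (e θ * v θ)‖ ^ 2 = ‖v' θ + Complex.I * a θ * v θ‖ ^ 2 := fun θ => by
    rw [← one_mul ‖v' θ + Complex.I * a θ * v θ‖, ← hen θ, ← norm_mul]
    congr 2
    push_cast
    ring
  simpa only [e1, e2] using key

/-- Argument principle for an injective map: the logarithmic derivative around an attained value. -/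
lemma circleIntegral_logDeriv_of_mem {G : ℂ → ℂ} (hG : DifferentiableOn ℂ G (Metric.ball 0 1))
    (hinj : Set.InjOn G (Metric.ball 0 1)) (hG' : ∀ z ∈ Metric.ball (0 : ℂ) 1, deriv G z ≠ 0)
    {ρ : ℝ} (hρ0 : 0 < ρ) (hρ : ρ < 1) {η : ℂ} (hη : η ∈ Metric.ball (0 : ℂ) ρ) :
    ∮ z in C(0, ρ), deriv G z / (G z - G η) = 2 * Real.pi * Complex.I := by
  have hsub : Metric.closedBall (0 : ℂ) ρ ⊆ Metric.ball 0 1 := Metric.closedBall_subset_ball hρ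
  have hη1 : η ∈ Metric.ball (0 : ℂ) 1 := Metric.ball_subset_ball hρ.le hη
  have hopen : IsOpen (Metric.ball (0 : ℂ) 1) := Metric.isOpen_ball
  set k := dslope G η with hk
  have hkd : DifferentiableOn ℂ k (Metric.ball 0 1) :=
    (Complex.differentiableOn_dslope (hopen.mem_nhds hη1)).2 hG
  have hk0 : ∀ z ∈ Metric.ball (0 : ℂ) 1, k z ≠ 0 := by
    intro z hz
    rcases eq_or_ne z η with rfl | hne
    · simpa [hk, dslope_same] using hG' z hz
    · rw [hk, dslope_of_ne _ hne, slope_def_field]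
      exact div_ne_zero (sub_ne_zero.2 fun h => hne (hinj hz hη1 h)) (sub_ne_zero.2 hne)
  have hfac : ∀ z, G z - G η = (z - η) * k z := fun z => by
    rw [← smul_eq_mul, hk, sub_smul_dslope]
  have hkdiv : DifferentiableOn ℂ (fun z => deriv k z / k z) (Metric.ball 0 1) :=
    (hkd.deriv hopen).div hkd hk0
  have hsphne : ∀ z ∈ Metric.sphere (0 : ℂ) ρ, z - η ≠ 0 := by
    intro z hz h
    rw [sub_eq_zero] at h
    subst h
    rw [mem_sphere_zero_iff_norm] at hz
    rw [mem_ball_zero_iff] at hη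
    exact absurd hz hη.ne
  have hcongr : Set.EqOn (fun z => deriv G z / (G z - G η))
      (fun z => (z - η)⁻¹ + deriv k z / k z) (Metric.sphere 0 ρ) := by
    intro z hz
    have hz1 := hsub (Metric.sphere_subset_closedBall hz)
    have hd : deriv G z = k z + (z - η) * deriv k z := by
      have h1 : HasDerivAt (fun z => (z - η) * k z) (1 * k z + (z - η) * deriv k z) z :=
        ((hasDerivAt_id z).sub_const η).mul
          ((hkd z hz1).differentiableAt (hopen.mem_nhds hz1)).hasDerivAt
      have h2 : G = fun z => (z - η) * k z + G η := by
        ext z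
        rw [← hfac]
        ring
      have h3 := h1.add_const (G η)
      rw [← h2] at h3
      rw [h3.deriv, one_mul]
    have h0 := hsphne z hz
    have h1 := hk0 z hz1
    simp only [hd, hfac]
    field_simp
  rw [circleIntegral.integral_congr hρ0.le hcongr, circleIntegral.integral_add,
    circleIntegral.integral_sub_inv_of_mem_ball hη,
    Complex.circleIntegral_eq_zero_of_differentiable_on_off_countable hρ0.le
      Set.countable_empty (hkdiv.continuousOn.mono hsub), add_zero]
  · intro z hz
    exact (hkdiv z (Metric.ball_subset_ball hρ.le hz.1)).differentiableAt
      (hopen.mem_nhds (Metric.ball_subset_ball hρ.le hz.1))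
  · refine ContinuousOn.circleIntegrable hρ0.le ?_
    exact ContinuousOn.inv₀ (by fun_prop) hsphne
  · exact ContinuousOn.circleIntegrable hρ0.le
      (hkdiv.continuousOn.mono (Metric.sphere_subset_closedBall.trans hsub))

lemma circleIntegral_logDeriv_of_notMem {G : ℂ → ℂ}
    (hG : DifferentiableOn ℂ G (Metric.ball 0 1)) {ρ : ℝ} (hρ0 : 0 < ρ) (hρ : ρ < 1) {y : ℂ}
    (hy : ∀ z ∈ Metric.closedBall (0 : ℂ) ρ, G z ≠ y) :
    ∮ z in C(0, ρ), deriv G z / (G z - y) = 0 := by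
  have hsub : Metric.closedBall (0 : ℂ) ρ ⊆ Metric.ball 0 1 := Metric.closedBall_subset_ball hρ
  have hopen : IsOpen (Metric.ball (0 : ℂ) 1) := Metric.isOpen_ball
  have hd := hG.deriv hopen
  refine Complex.circleIntegral_eq_zero_of_differentiable_on_off_countable hρ0.le
      Set.countable_empty ?_ ?_
  · exact (hd.continuousOn.mono hsub).div ((hG.continuousOn.mono hsub).sub continuousOn_const)
      fun z hz => sub_ne_zero.2 (hy z hz)
  · intro z hz
    have hz1 := Metric.ball_subset_ball hρ.le hz.1
    exact ((hd z hz1).differentiableAt (hopen.mem_nhds hz1)).div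
      (((hG z hz1).differentiableAt (hopen.mem_nhds hz1)).sub_const y)
      (sub_ne_zero.2 (hy z (Metric.ball_subset_closedBall hz.1)))

/-- The winding number of `G ∘ circle` about a point it avoids is `0` or `1`. -/
lemma exists_circleIntegral_logDeriv {G : ℂ → ℂ}
    (hG : DifferentiableOn ℂ G (Metric.ball 0 1))
    (hinj : Set.InjOn G (Metric.ball 0 1)) (hG' : ∀ z ∈ Metric.ball (0 : ℂ) 1, deriv G z ≠ 0)
    {ρ : ℝ} (hρ0 : 0 < ρ) (hρ : ρ < 1) {y : ℂ} (hy : ∀ z ∈ Metric.sphere (0 : ℂ) ρ, G z ≠ y) :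
    ∃ p : ℕ, p ≤ 1 ∧ ∮ z in C(0, ρ), deriv G z / (G z - y) = 2 * Real.pi * Complex.I * p := by
  by_cases h : ∃ η ∈ Metric.ball (0 : ℂ) ρ, G η = y
  · obtain ⟨η, hη, rfl⟩ := h
    exact ⟨1, le_rfl, by simpa using circleIntegral_logDeriv_of_mem hG hinj hG' hρ0 hρ hη⟩
  · push Not at h
    refine ⟨0, zero_le_one, ?_⟩
    rw [circleIntegral_logDeriv_of_notMem hG hρ0 hρ]
    · simp
    · intro z hz
      rw [← Metric.ball_union_sphere] at hz
      exact hz.elim (h z) (hy z)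

/-- The integrand of the logarithmic derivative of `G - y` along a circle, by angle. -/
def angularLogDeriv (G : ℂ → ℂ) (ρ : ℝ) (y : ℂ) (θ : ℝ) : ℂ :=
  circleMap 0 ρ θ * Complex.I * deriv G (circleMap 0 ρ θ) / (G (circleMap 0 ρ θ) - y)

lemma circleMap_zero_mem_ball {ρ : ℝ} (hρ0 : 0 < ρ) (hρ : ρ < 1) (θ : ℝ) :
    circleMap 0 ρ θ ∈ Metric.ball (0 : ℂ) 1 := by
  rw [mem_ball_zero_iff, norm_circleMap_zero, abs_of_pos hρ0]
  exact hρ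

lemma circleMap_zero_add_pi (ρ θ : ℝ) : circleMap 0 ρ (θ + Real.pi) = -circleMap 0 ρ θ := by
  simp [circleMap, add_mul, Complex.exp_add, Complex.exp_pi_mul_I]

lemma continuous_deriv_comp_circleMap {G : ℂ → ℂ} (hG : DifferentiableOn ℂ G (Metric.ball 0 1))
    {ρ : ℝ} (hρ0 : 0 < ρ) (hρ : ρ < 1) : Continuous fun θ => deriv G (circleMap 0 ρ θ) :=
  (hG.deriv Metric.isOpen_ball).continuousOn.comp_continuous (continuous_circleMap 0 ρ)
    (circleMap_zero_mem_ball hρ0 hρ)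

lemma continuous_comp_circleMap {G : ℂ → ℂ} (hG : DifferentiableOn ℂ G (Metric.ball 0 1))
    {ρ : ℝ} (hρ0 : 0 < ρ) (hρ : ρ < 1) : Continuous fun θ => G (circleMap 0 ρ θ) :=
  hG.continuousOn.comp_continuous (continuous_circleMap 0 ρ) (circleMap_zero_mem_ball hρ0 hρ)

lemma continuous_angularLogDeriv {G : ℂ → ℂ} (hG : DifferentiableOn ℂ G (Metric.ball 0 1))
    {ρ : ℝ} (hρ0 : 0 < ρ) (hρ : ρ < 1) {y : ℂ} (hy : ∀ z ∈ Metric.sphere (0 : ℂ) ρ, G z ≠ y) :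
    Continuous (angularLogDeriv G ρ y) := by
  have h1 := continuous_deriv_comp_circleMap hG hρ0 hρ
  have h2 := continuous_comp_circleMap hG hρ0 hρ
  have h3 := continuous_circleMap 0 ρ
  unfold angularLogDeriv
  exact Continuous.div (by fun_prop) (h2.sub continuous_const)
    fun θ => sub_ne_zero.2 (hy _ (circleMap_mem_sphere 0 hρ0.le θ))

lemma angularLogDeriv_add_two_pi (G : ℂ → ℂ) (ρ : ℝ) (y : ℂ) :
    Function.Periodic (angularLogDeriv G ρ y) (2 * Real.pi) := fun θ => by
  simp only [angularLogDeriv, periodic_circleMap 0 ρ θ]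

lemma integral_angularLogDeriv (G : ℂ → ℂ) (ρ : ℝ) (y : ℂ) (s : ℝ) :
    ∫ θ in s..s + 2 * Real.pi, angularLogDeriv G ρ y θ =
      ∮ z in C(0, ρ), deriv G z / (G z - y) := by
  rw [(angularLogDeriv_add_two_pi G ρ y).intervalIntegral_add_eq s 0, zero_add, circleIntegral]
  refine intervalIntegral.integral_congr fun θ _ => ?_
  simp only [angularLogDeriv, deriv_circleMap, smul_eq_mul, mul_div_assoc]

lemma deriv_neg_of_odd {G : ℂ → ℂ} (hG : DifferentiableOn ℂ G (Metric.ball 0 1))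
    (hodd : ∀ z ∈ Metric.ball (0 : ℂ) 1, G (-z) = -G z) {z : ℂ} (hz : z ∈ Metric.ball (0 : ℂ) 1) :
    deriv G (-z) = deriv G z := by
  have hopen : IsOpen (Metric.ball (0 : ℂ) 1) := Metric.isOpen_ball
  have hz' : -z ∈ Metric.ball (0 : ℂ) 1 := by simpa using hz
  have h1 : HasDerivAt (fun w => G (-w)) (-deriv G (-z)) z := by
    have := (((hG _ hz').differentiableAt (hopen.mem_nhds hz')).hasDerivAt).scomp z
      (hasDerivAt_neg z)
    simpa [Function.comp_def] using this
  have h2 : (fun w => G (-w)) =ᶠ[nhds z] fun w => -G w := by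
    filter_upwards [hopen.mem_nhds hz] with w hw using hodd w hw
  have h3 := h2.deriv_eq
  rw [h1.deriv, deriv.fun_neg] at h3
  exact neg_injective h3

lemma angularLogDeriv_neg {G : ℂ → ℂ} (hG : DifferentiableOn ℂ G (Metric.ball 0 1))
    (hodd : ∀ z ∈ Metric.ball (0 : ℂ) 1, G (-z) = -G z)
    {ρ : ℝ} (hρ0 : 0 < ρ) (hρ : ρ < 1) (y : ℂ) (θ : ℝ) :
    angularLogDeriv G ρ (-y) θ = angularLogDeriv G ρ y (θ + Real.pi) := by
  have hm := circleMap_zero_mem_ball hρ0 hρ θ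
  simp only [angularLogDeriv, circleMap_zero_add_pi, hodd _ hm, deriv_neg_of_odd hG hodd hm]
  rw [← neg_div_neg_eq]
  congr 1 <;> ring

lemma integral_angularLogDeriv_add_neg {G : ℂ → ℂ}
    (hG : DifferentiableOn ℂ G (Metric.ball 0 1))
    (hodd : ∀ z ∈ Metric.ball (0 : ℂ) 1, G (-z) = -G z)
    {ρ : ℝ} (hρ0 : 0 < ρ) (hρ : ρ < 1) {y : ℂ} (hy : ∀ z ∈ Metric.sphere (0 : ℂ) ρ, G z ≠ y)
    (s : ℝ) :
    ∫ θ in s..s + Real.pi, (angularLogDeriv G ρ y θ + angularLogDeriv G ρ (-y) θ) =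
      ∮ z in C(0, ρ), deriv G z / (G z - y) := by
  have hc := continuous_angularLogDeriv hG hρ0 hρ hy
  have hc2 : Continuous fun θ => angularLogDeriv G ρ y (θ + Real.pi) := by fun_prop
  simp only [angularLogDeriv_neg hG hodd hρ0 hρ]
  rw [intervalIntegral.integral_add (hc.intervalIntegrable _ _)
    (hc2.intervalIntegrable _ _),
    intervalIntegral.integral_comp_add_right (fun θ => angularLogDeriv G ρ y θ),
    intervalIntegral.integral_add_adjacent_intervals (hc.intervalIntegrable _ _)
      (hc.intervalIntegrable _ _), ← integral_angularLogDeriv G ρ y s]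
  congr 1
  ring

/-- An odd conformal parametrization of a planar domain by the unit disk. -/
structure IsOddChart (G : ℂ → ℂ) : Prop where
  diff : DifferentiableOn ℂ G (Metric.ball 0 1)
  inj : Set.InjOn G (Metric.ball 0 1)
  deriv_ne : ∀ z ∈ Metric.ball (0 : ℂ) 1, deriv G z ≠ 0
  odd : ∀ z ∈ Metric.ball (0 : ℂ) 1, G (-z) = -G z

lemma IsOddChart.map_zero {G : ℂ → ℂ} (hG : IsOddChart G) : G 0 = 0 := by
  have := hG.odd 0 (by simp)
  rw [neg_zero] at this
  exact self_eq_neg.1 this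

lemma IsOddChart.hasDerivAt {G : ℂ → ℂ} (hG : IsOddChart G) {z : ℂ}
    (hz : z ∈ Metric.ball (0 : ℂ) 1) : HasDerivAt G (deriv G z) z :=
  ((hG.diff z hz).differentiableAt (Metric.isOpen_ball.mem_nhds hz)).hasDerivAt

/-- Gauge field of a relative coordinate in the presence of antipodal vortex pairs `± Y l`. -/
def relGauge {ι : Type*} (s : Finset ι) (Y : ι → ℂ) (y : ℂ) : ℂ :=
  1 / y + ∑ l ∈ s, (1 / (y - Y l) + 1 / (y + Y l))

/-- Covariant derivative (up to a factor `-i`) in the direction `h` for the gauge field `K`. -/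
def relCov (α : ℝ) (K U : ℂ → ℂ) (y h : ℂ) : ℂ :=
  fderiv ℝ U y h + Complex.I * ((α * (h * K y).im : ℝ) : ℂ) * U y

lemma norm_sq_relCov_le (α : ℝ) (K U : ℂ → ℂ) (y h : ℂ) :
    ‖relCov α K U y h‖ ^ 2 ≤
      ‖h‖ ^ 2 * (‖relCov α K U y 1‖ ^ 2 + ‖relCov α K U y Complex.I‖ ^ 2) := by
  have e : relCov α K U y h = h.re * relCov α K U y 1 + h.im * relCov α K U y Complex.I := by
    have h1 : fderiv ℝ U y h = h.re * fderiv ℝ U y 1 + h.im * fderiv ℝ U y Complex.I := by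
      conv_lhs => rw [show h = h.re • (1 : ℂ) + h.im • Complex.I by simp, map_add, map_smul,
        map_smul]
      simp
    simp only [relCov, h1]
    simp
    ring
  rw [e]
  set A := relCov α K U y 1
  set B := relCov α K U y Complex.I
  have h2 : ‖(h.re : ℂ) * A + h.im * B‖ ≤ |h.re| * ‖A‖ + |h.im| * ‖B‖ := by
    refine (norm_add_le _ _).trans ?_
    simp
  have h3 : ‖h‖ ^ 2 = |h.re| ^ 2 + |h.im| ^ 2 := by
    rw [sq_abs, sq_abs, ← Complex.normSq_eq_norm_sq, Complex.normSq_apply]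
    ring
  calc _ ≤ (|h.re| * ‖A‖ + |h.im| * ‖B‖) ^ 2 := by gcongr
    _ ≤ _ := by
      rw [h3]
      nlinarith [sq_nonneg (|h.re| * ‖B‖ - |h.im| * ‖A‖)]

lemma integral_angular_relGauge {ι : Type*} {s : Finset ι} {Y : ι → ℂ} {G : ℂ → ℂ}
    (hG : IsOddChart G) {ρ : ℝ} (hρ0 : 0 < ρ) (hρ : ρ < 1)
    (hY : ∀ l ∈ s, ∀ z ∈ Metric.sphere (0 : ℂ) ρ, G z ≠ Y l) (t : ℝ) :
    (Continuous fun θ => circleMap 0 ρ θ * Complex.I * deriv G (circleMap 0 ρ θ) *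
        relGauge s Y (G (circleMap 0 ρ θ))) ∧
    ∃ p : ℕ, p ≤ s.card ∧ ∫ θ in t..t + Real.pi, circleMap 0 ρ θ * Complex.I *
      deriv G (circleMap 0 ρ θ) * relGauge s Y (G (circleMap 0 ρ θ)) =
        Real.pi * Complex.I * (2 * p + 1) := by
  have h0 : ∀ z ∈ Metric.sphere (0 : ℂ) ρ, G z ≠ 0 := by
    intro z hz h
    have hz1 : z ∈ Metric.ball (0 : ℂ) 1 :=
      Metric.closedBall_subset_ball hρ (Metric.sphere_subset_closedBall hz)
    have := hG.inj hz1 (by simp) (h.trans hG.map_zero.symm)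
    simp [this] at hz
    exact hρ0.ne hz
  have hform : ∀ θ, circleMap 0 ρ θ * Complex.I * deriv G (circleMap 0 ρ θ) *
      relGauge s Y (G (circleMap 0 ρ θ)) = angularLogDeriv G ρ 0 θ +
        ∑ l ∈ s, (angularLogDeriv G ρ (Y l) θ + angularLogDeriv G ρ (-Y l) θ) := by
    intro θ
    simp only [relGauge, angularLogDeriv, mul_add, Finset.mul_sum, sub_zero, sub_neg_eq_add,
      mul_one_div]
  have c0 := continuous_angularLogDeriv hG.diff hρ0 hρ h0
  have c1 : ∀ l ∈ s, Continuous fun θ =>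
      angularLogDeriv G ρ (Y l) θ + angularLogDeriv G ρ (-Y l) θ := by
    intro l hl
    have hc := continuous_angularLogDeriv hG.diff hρ0 hρ (hY l hl)
    simp only [angularLogDeriv_neg hG.diff hG.odd hρ0 hρ]
    fun_prop
  choose! p hp1 hp using fun l hl =>
    exists_circleIntegral_logDeriv hG.diff hG.inj hG.deriv_ne hρ0 hρ (hY l hl)
  have i0 : ∫ θ in t..t + Real.pi, angularLogDeriv G ρ 0 θ = Real.pi * Complex.I := by
    have h1 := integral_angularLogDeriv_add_neg hG.diff hG.odd hρ0 hρ h0 t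
    have h2 := circleIntegral_logDeriv_of_mem hG.diff hG.inj hG.deriv_ne hρ0 hρ
      (Metric.mem_ball_self hρ0)
    rw [hG.map_zero] at h2
    rw [h2, neg_zero, intervalIntegral.integral_add (c0.intervalIntegrable _ _)
      (c0.intervalIntegrable _ _)] at h1
    linear_combination h1 / 2
  have hii : ∀ l ∈ s, IntervalIntegrable (fun θ =>
      angularLogDeriv G ρ (Y l) θ + angularLogDeriv G ρ (-Y l) θ) volume t (t + Real.pi) :=
    fun l hl => (c1 l hl).intervalIntegrable _ _
  simp only [hform]
  refine ⟨c0.add (continuous_finsetSum _ c1), ∑ l ∈ s, p l, ?_, ?_⟩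
  · simpa using Finset.sum_le_card_nsmul s p 1 hp1
  · rw [intervalIntegral.integral_add (c0.intervalIntegrable _ _)
      ((continuous_finsetSum s c1).intervalIntegrable _ _), i0,
      intervalIntegral.integral_finsetSum hii,
      Finset.sum_congr rfl fun l hl => (integral_angularLogDeriv_add_neg hG.diff hG.odd hρ0 hρ
        (hY l hl) t).trans (hp l hl), ← Finset.mul_sum]
    push_cast
    ring

/-- Hardy-type bound on the image of a half circle. -/
lemma sq_mul_integral_halfCircle_le {ι : Type*} {s : Finset ι} {Y : ι → ℂ} {G : ℂ → ℂ}
    (hG : IsOddChart G) {ρ : ℝ} (hρ0 : 0 < ρ) (hρ : ρ < 1)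
    (hY : ∀ l ∈ s, ∀ z ∈ Metric.sphere (0 : ℂ) ρ, G z ≠ Y l) {α c : ℝ} (hc0 : 0 ≤ c)
    (hc : ∀ p : ℕ, p ≤ s.card → ∀ q : ℤ, c ≤ |(2 * (p : ℝ) + 1) * α - 2 * q|)
    {U : ℂ → ℂ} (hU : ContDiff ℝ 1 U) (heven : ∀ y, U (-y) = U y) (t : ℝ) :
    (Continuous fun θ => relCov α (relGauge s Y) U (G (circleMap 0 ρ θ))
        (circleMap 0 ρ θ * Complex.I * deriv G (circleMap 0 ρ θ))) ∧
    c ^ 2 * ∫ θ in t..t + Real.pi, ‖U (G (circleMap 0 ρ θ))‖ ^ 2 ≤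
      ∫ θ in t..t + Real.pi, ‖relCov α (relGauge s Y) U (G (circleMap 0 ρ θ))
        (circleMap 0 ρ θ * Complex.I * deriv G (circleMap 0 ρ θ))‖ ^ 2 := by
  obtain ⟨ac, p, hp, hint⟩ := integral_angular_relGauge hG hρ0 hρ hY t
  have hm := circleMap_zero_mem_ball hρ0 hρ
  have hGc := continuous_comp_circleMap hG.diff hρ0 hρ
  have hG'c := continuous_deriv_comp_circleMap hG.diff hρ0 hρ
  have hcm := continuous_circleMap 0 ρ
  set w : ℝ → ℂ := fun θ => circleMap 0 ρ θ * Complex.I * deriv G (circleMap 0 ρ θ) with hw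
  have hwc : Continuous w := by fun_prop
  have hd : ∀ θ, HasDerivAt (fun θ => U (G (circleMap 0 ρ θ)))
      (fderiv ℝ U (G (circleMap 0 ρ θ)) (w θ)) θ := by
    intro θ
    have h1 : HasDerivAt (fun θ => G (circleMap 0 ρ θ)) (w θ) θ := by
      have := (hG.hasDerivAt (hm θ)).comp θ (hasDerivAt_circleMap 0 ρ θ)
      rw [mul_comm] at this
      exact this
    exact ((hU.differentiable one_ne_zero _).hasFDerivAt).comp_hasDerivAt θ h1
  have hv'c : Continuous fun θ => fderiv ℝ U (G (circleMap 0 ρ θ)) (w θ) :=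
    ((hU.continuous_fderiv one_ne_zero).comp hGc).clm_apply hwc
  set a : ℝ → ℝ := fun θ => α * (w θ * relGauge s Y (G (circleMap 0 ρ θ))).im with ha
  have hac : Continuous a := continuous_const.mul (Complex.continuous_im.comp ac)
  have hflux : ∫ θ in t..t + Real.pi, a θ = ((2 * p + 1) * α) * Real.pi := by
    rw [intervalIntegral.integral_const_mul]
    have h1 := Complex.imCLM.intervalIntegral_comp_comm
      (ac.intervalIntegrable (μ := volume) t (t + Real.pi))
    simp only [Complex.imCLM_apply] at h1
    rw [h1, hint]
    simp
    ring
  have hper : U (G (circleMap 0 ρ (t + Real.pi))) = U (G (circleMap 0 ρ t)) := by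
    rw [circleMap_zero_add_pi, hG.odd _ (hm t), heven]
  have hUc := hU.continuous
  refine ⟨?_, sq_mul_integral_le_of_flux Real.pi_pos hd hv'c hac hper hflux hc0 fun n => ?_⟩
  · exact hv'c.add ((continuous_const.mul (Complex.continuous_ofReal.comp hac)).mul
      (hUc.comp hGc))
  · have := hc p hp (-n)
    rw [mul_div_assoc, div_self Real.pi_ne_zero]
    push_cast at this
    convert this using 2
    ring

lemma ofReal_sq_mul_lintegral_circle_le {ι : Type*} {s : Finset ι} {Y : ι → ℂ} {G : ℂ → ℂ}
    (hG : IsOddChart G) {ρ : ℝ} (hρ0 : 0 < ρ) (hρ : ρ < 1)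
    (hY : ∀ l ∈ s, ∀ z ∈ Metric.sphere (0 : ℂ) ρ, G z ≠ Y l) {α c : ℝ} (hc0 : 0 ≤ c)
    (hc : ∀ p : ℕ, p ≤ s.card → ∀ q : ℤ, c ≤ |(2 * (p : ℝ) + 1) * α - 2 * q|)
    {U : ℂ → ℂ} (hU : ContDiff ℝ 1 U) (heven : ∀ y, U (-y) = U y) :
    ∫⁻ θ in Set.Ioo (-Real.pi) Real.pi,
        ENNReal.ofReal (c ^ 2 * ‖U (G (circleMap 0 ρ θ))‖ ^ 2) ≤
      ∫⁻ θ in Set.Ioo (-Real.pi) Real.pi,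
        ENNReal.ofReal (‖relCov α (relGauge s Y) U (G (circleMap 0 ρ θ))
          (circleMap 0 ρ θ * Complex.I * deriv G (circleMap 0 ρ θ))‖ ^ 2) := by
  obtain ⟨hcont, h1⟩ := sq_mul_integral_halfCircle_le hG hρ0 hρ hY hc0 hc hU heven (-Real.pi)
  have h2 := (sq_mul_integral_halfCircle_le hG hρ0 hρ hY hc0 hc hU heven 0).2
  have hUc : Continuous fun θ => U (G (circleMap 0 ρ θ)) :=
    hU.continuous.comp (continuous_comp_circleMap hG.diff hρ0 hρ)
  have hI : ∀ g : ℝ → ℝ, Continuous g → (∀ θ, 0 ≤ g θ) →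
      ∫⁻ θ in Set.Ioo (-Real.pi) Real.pi, ENNReal.ofReal (g θ) =
        ENNReal.ofReal ((∫ θ in -Real.pi..-Real.pi + Real.pi, g θ) +
          ∫ θ in 0..0 + Real.pi, g θ) := by
    intro g hg hg0
    rw [neg_add_cancel, zero_add, intervalIntegral.integral_add_adjacent_intervals
      (hg.intervalIntegrable _ _) (hg.intervalIntegrable _ _),
      intervalIntegral.integral_of_le (by linarith [Real.pi_pos]),
      setLIntegral_congr Ioo_ae_eq_Ioc, ofReal_integral_eq_lintegral_ofReal]
    · exact (hg.intervalIntegrable (-Real.pi) Real.pi).1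
    · exact Filter.Eventually.of_forall hg0
  have hL : Continuous fun θ => c ^ 2 * ‖U (G (circleMap 0 ρ θ))‖ ^ 2 :=
    continuous_const.mul (hUc.norm.pow 2)
  rw [hI _ hL (fun _ => by positivity), hI _ (by exact hcont.norm.pow 2) (fun _ => by positivity)]
  refine ENNReal.ofReal_le_ofReal ?_
  simp only [intervalIntegral.integral_const_mul]
  exact add_le_add h1 h2

lemma lintegral_unitBall_eq_polar (h : ℂ → ENNReal) :
    ∫⁻ z in Metric.ball (0 : ℂ) 1, h z =
      ∫⁻ p in Set.Ioo (0 : ℝ) 1 ×ˢ Set.Ioo (-Real.pi) Real.pi,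
        ENNReal.ofReal p.1 * h (circleMap 0 p.1 p.2) := by
  have hsymm : ∀ p : ℝ × ℝ, Complex.polarCoord.symm p = circleMap 0 p.1 p.2 := fun p => by
    rw [Complex.polarCoord_symm_apply, circleMap, Complex.exp_mul_I]
    simp
  have hset : Set.Ioo (0 : ℝ) 1 ×ˢ Set.Ioo (-Real.pi) Real.pi =
      (Set.Iio (1 : ℝ) ×ˢ Set.univ) ∩ polarCoord.target := by
    ext p
    simp only [polarCoord_target, Set.mem_inter_iff, Set.mem_prod, Set.mem_Ioo, Set.mem_Iio,
      Set.mem_univ, Set.mem_Ioi]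
    tauto
  have hm : MeasurableSet (Set.Iio (1 : ℝ) ×ˢ (Set.univ : Set ℝ)) :=
    measurableSet_Iio.prod MeasurableSet.univ
  rw [← lintegral_indicator Metric.isOpen_ball.measurableSet,
    ← Complex.lintegral_comp_polarCoord_symm, hset, ← Measure.restrict_restrict hm,
    ← lintegral_indicator hm]
  refine setLIntegral_congr_fun polarCoord.open_target.measurableSet fun p hp => ?_
  have hp1 : 0 < p.1 := by
    rw [polarCoord_target] at hp
    exact hp.1
  simp only [hsymm, smul_eq_mul]
  by_cases h1 : p.1 < 1
  · rw [Set.indicator_of_mem (circleMap_zero_mem_ball hp1 h1 p.2),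
      Set.indicator_of_mem (by simpa using h1)]
  · rw [Set.indicator_of_notMem, Set.indicator_of_notMem (by simpa using h1), mul_zero]
    rw [mem_ball_zero_iff, norm_circleMap_zero, abs_of_pos hp1]
    exact h1

lemma det_smul_one_complex (c : ℂ) : (c • (1 : ℂ →L[ℝ] ℂ)).det = ‖c‖ ^ 2 := by
  rw [← Complex.normSq_eq_norm_sq, ← Algebra.norm_complex_apply, Algebra.norm_apply]
  rfl

lemma IsOddChart.lintegral_image {G : ℂ → ℂ} (hG : IsOddChart G) (g : ℂ → ENNReal) :
    ∫⁻ y in G '' Metric.ball 0 1, g y =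
      ∫⁻ p in Set.Ioo (0 : ℝ) 1 ×ˢ Set.Ioo (-Real.pi) Real.pi,
        ENNReal.ofReal p.1 * (ENNReal.ofReal (‖deriv G (circleMap 0 p.1 p.2)‖ ^ 2) *
          g (G (circleMap 0 p.1 p.2))) := by
  rw [lintegral_image_eq_lintegral_abs_det_fderiv_mul volume Metric.isOpen_ball.measurableSet
    (fun z hz => (hG.hasDerivAt hz).complexToReal_fderiv.hasFDerivWithinAt) hG.inj,
    lintegral_unitBall_eq_polar]
  simp only [det_smul_one_complex, abs_pow, abs_norm]

lemma measurable_relGauge {ι : Type*} (s : Finset ι) (Y : ι → ℂ) :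
    Measurable (relGauge s Y) := by
  unfold relGauge
  fun_prop

lemma measurable_relCov (α : ℝ) {K U : ℂ → ℂ} (hK : Measurable K) (hU : ContDiff ℝ 1 U) (h : ℂ) :
    Measurable fun y => relCov α K U y h := by
  have h1 : Measurable fun y => fderiv ℝ U y h :=
    ((hU.continuous_fderiv one_ne_zero).clm_apply continuous_const).measurable
  have h2 := hU.continuous.measurable
  have h3 : Measurable fun y => (h * K y).im := Complex.measurable_im.comp (by fun_prop)
  unfold relCov
  fun_prop

lemma IsOddChart.finite_exceptional_radii {ι : Type*} {s : Finset ι} {Y : ι → ℂ} {G : ℂ → ℂ}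
    (hG : IsOddChart G) :
    {ρ ∈ Set.Ioo (0 : ℝ) 1 | ∃ l ∈ s, ∃ z ∈ Metric.sphere (0 : ℂ) ρ, G z = Y l}.Finite := by
  have : {ρ ∈ Set.Ioo (0 : ℝ) 1 | ∃ l ∈ s, ∃ z ∈ Metric.sphere (0 : ℂ) ρ, G z = Y l} ⊆
      ⋃ l ∈ s, {ρ ∈ Set.Ioo (0 : ℝ) 1 | ∃ z ∈ Metric.sphere (0 : ℂ) ρ, G z = Y l} := by
    rintro ρ ⟨hρ, l, hl, h⟩
    simp only [Set.mem_iUnion]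
    exact ⟨l, hl, hρ, h⟩
  refine Set.Finite.subset (s.finite_toSet.biUnion fun l _ => Set.Subsingleton.finite ?_) this
  rintro ρ ⟨hρ, z, hz, h⟩ ρ' ⟨hρ', z', hz', h'⟩
  rw [mem_sphere_zero_iff_norm] at hz hz'
  have : z = z' := hG.inj (by simpa [hz] using hρ.2) (by simpa [hz'] using hρ'.2) (h.trans h'.symm)
  rw [← hz, ← hz', this]

/-- Conformally transported Hardy inequality for an even function in the field of a flux through
the origin and antipodal vortex pairs. -/
lemma IsOddChart.hardy {ι : Type*} {s : Finset ι} {Y : ι → ℂ} {G : ℂ → ℂ}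
    (hG : IsOddChart G) {W : ℂ → ℝ}
    (hW : ∀ z ∈ Metric.ball (0 : ℂ) 1, z ≠ 0 → W (G z) * (‖z‖ * ‖deriv G z‖) ^ 2 = 1)
    {α c : ℝ} (hc0 : 0 ≤ c)
    (hc : ∀ p : ℕ, p ≤ s.card → ∀ q : ℤ, c ≤ |(2 * (p : ℝ) + 1) * α - 2 * q|)
    {U : ℂ → ℂ} (hU : ContDiff ℝ 1 U) (heven : ∀ y, U (-y) = U y) :
    ∫⁻ y in G '' Metric.ball 0 1, ENNReal.ofReal (c ^ 2 * (W y * ‖U y‖ ^ 2)) ≤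
      ∫⁻ y in G '' Metric.ball 0 1, ENNReal.ofReal (‖relCov α (relGauge s Y) U y 1‖ ^ 2 +
        ‖relCov α (relGauge s Y) U y Complex.I‖ ^ 2) := by
  set E : ℂ → ℝ := fun y => ‖relCov α (relGauge s Y) U y 1‖ ^ 2 +
        ‖relCov α (relGauge s Y) U y Complex.I‖ ^ 2 with hE
  have hEm : Measurable E :=
    ((measurable_relCov α (measurable_relGauge s Y) hU 1).norm.pow_const 2).add
      ((measurable_relCov α (measurable_relGauge s Y) hU Complex.I).norm.pow_const 2)
  have hcm : ContinuousOn (fun p : ℝ × ℝ => circleMap 0 p.1 p.2)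
      (Set.Ioo (0 : ℝ) 1 ×ˢ Set.Ioo (-Real.pi) Real.pi) := by
    unfold circleMap
    fun_prop
  have hmaps : Set.MapsTo (fun p : ℝ × ℝ => circleMap 0 p.1 p.2)
      (Set.Ioo (0 : ℝ) 1 ×ˢ Set.Ioo (-Real.pi) Real.pi) (Metric.ball 0 1) :=
    fun p hp => circleMap_zero_mem_ball hp.1.1 hp.1.2 _
  have hms : MeasurableSet (Set.Ioo (0 : ℝ) 1 ×ˢ Set.Ioo (-Real.pi) Real.pi) :=
    measurableSet_Ioo.prod measurableSet_Ioo
  have hRm : AEMeasurable (fun p : ℝ × ℝ => ENNReal.ofReal p.1 *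
      (ENNReal.ofReal (‖deriv G (circleMap 0 p.1 p.2)‖ ^ 2) *
        ENNReal.ofReal (E (G (circleMap 0 p.1 p.2)))))
      ((volume.prod volume).restrict (Set.Ioo (0 : ℝ) 1 ×ˢ Set.Ioo (-Real.pi) Real.pi)) := by
    have m1 : AEMeasurable (fun p : ℝ × ℝ => ENNReal.ofReal (‖deriv G (circleMap 0 p.1 p.2)‖ ^ 2))
        ((volume.prod volume).restrict (Set.Ioo (0 : ℝ) 1 ×ˢ Set.Ioo (-Real.pi) Real.pi)) :=
      ENNReal.measurable_ofReal.comp_aemeasurable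
        (((((hG.diff.deriv Metric.isOpen_ball).continuousOn.comp hcm hmaps)).norm).aemeasurable
          hms |>.pow_const 2)
    have m2 : AEMeasurable (fun p : ℝ × ℝ => ENNReal.ofReal (E (G (circleMap 0 p.1 p.2))))
        ((volume.prod volume).restrict (Set.Ioo (0 : ℝ) 1 ×ˢ Set.Ioo (-Real.pi) Real.pi)) :=
      (ENNReal.measurable_ofReal.comp hEm).comp_aemeasurable
        ((hG.diff.continuousOn.comp hcm hmaps).aemeasurable hms)
    fun_prop
  rw [hG.lintegral_image, hG.lintegral_image, Measure.volume_eq_prod, setLIntegral_prod _ hRm,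
    ← Measure.prod_restrict]
  refine (lintegral_prod_le _).trans (lintegral_mono_ae ?_)
  have hex := (hG.finite_exceptional_radii (s := s) (Y := Y)).measure_zero volume
  have hae : ∀ᵐ ρ : ℝ, ρ ∉ {ρ ∈ Set.Ioo (0 : ℝ) 1 |
      ∃ l ∈ s, ∃ z ∈ Metric.sphere (0 : ℂ) ρ, G z = Y l} := measure_eq_zero_iff_ae_notMem.1 hex
  filter_upwards [ae_restrict_mem measurableSet_Ioo, ae_restrict_of_ae hae] with ρ hρ hρ'
  have hY : ∀ l ∈ s, ∀ z ∈ Metric.sphere (0 : ℂ) ρ, G z ≠ Y l :=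
    fun l hl z hz h => hρ' ⟨hρ, l, hl, z, hz, h⟩
  have key := ofReal_sq_mul_lintegral_circle_le hG hρ.1 hρ.2 hY hc0 hc hU heven
  have hn : ∀ θ, ‖circleMap 0 ρ θ‖ = ρ := fun θ => by
    rw [norm_circleMap_zero, abs_of_pos hρ.1]
  have hρ0 : ρ ≠ 0 := hρ.1.ne'
  calc _ = ∫⁻ θ in Set.Ioo (-Real.pi) Real.pi, ENNReal.ofReal ρ⁻¹ *
          ENNReal.ofReal (c ^ 2 * ‖U (G (circleMap 0 ρ θ))‖ ^ 2) := by
        refine lintegral_congr fun θ => ?_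
        have hz : circleMap 0 ρ θ ≠ 0 := fun h => by simpa [h, hρ0.symm] using hn θ
        have h1 := hW _ (circleMap_zero_mem_ball hρ.1 hρ.2 θ) hz
        rw [hn] at h1
        rw [← ENNReal.ofReal_mul (by positivity), ← ENNReal.ofReal_mul hρ.1.le,
          ← ENNReal.ofReal_mul (by have := hρ.1; positivity)]
        congr 1
        field_simp
        linear_combination (c ^ 2 * ‖U (G (circleMap 0 ρ θ))‖ ^ 2) * h1
    _ ≤ ∫⁻ θ in Set.Ioo (-Real.pi) Real.pi, ENNReal.ofReal ρ⁻¹ *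
          ENNReal.ofReal (‖relCov α (relGauge s Y) U (G (circleMap 0 ρ θ))
            (circleMap 0 ρ θ * Complex.I * deriv G (circleMap 0 ρ θ))‖ ^ 2) := by
        rw [lintegral_const_mul' _ _ ENNReal.ofReal_ne_top,
          lintegral_const_mul' _ _ ENNReal.ofReal_ne_top]
        gcongr
    _ ≤ _ := by
        refine lintegral_mono fun θ => ?_
        dsimp only
        rw [← ENNReal.ofReal_mul (inv_nonneg.2 hρ.1.le), ← ENNReal.ofReal_mul (by positivity),
          ← ENNReal.ofReal_mul hρ.1.le]
        refine ENNReal.ofReal_le_ofReal ?_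
        have h1 := norm_sq_relCov_le α (relGauge s Y) U (G (circleMap 0 ρ θ))
          (circleMap 0 ρ θ * Complex.I * deriv G (circleMap 0 ρ θ))
        rw [norm_mul, norm_mul, hn, Complex.norm_I, mul_one] at h1
        rw [inv_mul_le_iff₀ hρ.1]
        calc _ ≤ _ := h1
          _ = _ := by ring

/-- Möbius map from the unit disk to the right half plane. -/
def diskToHalf (F : ℂ) : ℂ := (1 + F) / (1 - F)

lemma one_add_ne_zero_of_re_pos {w : ℂ} (hw : 0 < w.re) : w + 1 ≠ 0 := fun h => by
  have := congrArg Complex.re h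
  simp at this
  linarith

lemma one_sub_ne_zero_of_norm_lt {F : ℂ} (hF : ‖F‖ < 1) : 1 - F ≠ 0 := fun h => by
  rw [sub_eq_zero] at h
  simp [← h] at hF

lemma one_add_ne_zero_of_norm_lt {F : ℂ} (hF : ‖F‖ < 1) : 1 + F ≠ 0 := by
  have := one_sub_ne_zero_of_norm_lt (F := -F) (by simpa using hF)
  simpa using this

lemma diskToHalf_re_pos {F : ℂ} (hF : ‖F‖ < 1) : 0 < (diskToHalf F).re := by
  have h0 := one_sub_ne_zero_of_norm_lt hF
  have hn : 0 < Complex.normSq (1 - F) := Complex.normSq_pos.2 h0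
  have h1 : Complex.normSq F < 1 := by
    rw [Complex.normSq_eq_norm_sq]
    have := norm_nonneg F
    nlinarith
  have : (diskToHalf F).re = (1 - Complex.normSq F) / Complex.normSq (1 - F) := by
    rw [diskToHalf, Complex.div_re, ← add_div]
    congr 1
    simp [Complex.normSq_apply]
    ring
  rw [this]
  exact div_pos (by linarith) hn

lemma diskToHalf_ne_zero {F : ℂ} (hF : ‖F‖ < 1) : diskToHalf F ≠ 0 := fun h => by
  have := diskToHalf_re_pos hF
  simp [h] at this

lemma diskToHalf_neg (F : ℂ) : diskToHalf (-F) = (diskToHalf F)⁻¹ := by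
  rw [diskToHalf, diskToHalf, inv_div, sub_neg_eq_add, ← sub_eq_add_neg]

lemma norm_halfToDisk_lt {W : ℂ} (hW : 0 < W.re) : ‖(W - 1) / (W + 1)‖ < 1 := by
  rw [norm_div, div_lt_one (norm_pos_iff.2 (one_add_ne_zero_of_re_pos hW)),
    ← sq_lt_sq₀ (norm_nonneg _) (norm_nonneg _), ← Complex.normSq_eq_norm_sq,
    ← Complex.normSq_eq_norm_sq, Complex.normSq_apply, Complex.normSq_apply]
  simp
  nlinarith

lemma diskToHalf_halfToDisk {W : ℂ} (hW : 0 < W.re) : diskToHalf ((W - 1) / (W + 1)) = W := by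
  have h1 := one_add_ne_zero_of_re_pos hW
  rw [diskToHalf]
  field_simp
  ring

lemma halfToDisk_diskToHalf {F : ℂ} (hF : ‖F‖ < 1) :
    (diskToHalf F - 1) / (diskToHalf F + 1) = F := by
  have h1 := one_sub_ne_zero_of_norm_lt hF
  rw [diskToHalf]
  field_simp
  ring

/-- The power `((1+F)/(1-F))^γ`, mapping the unit disk onto a sector. -/
def sectorMap (γ : ℝ) (F : ℂ) : ℂ := Complex.exp (γ * Complex.log (diskToHalf F))

lemma abs_im_log_lt {W : ℂ} (hW : 0 < W.re) : |(Complex.log W).im| < Real.pi / 2 := by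
  rw [Complex.log_im]
  exact Complex.abs_arg_lt_pi_div_two_iff.2 (Or.inl hW)

lemma abs_im_sectorMap_log_lt {γ : ℝ} (hγ0 : 0 < γ) {F : ℂ} (hF : ‖F‖ < 1) :
    |((γ : ℂ) * Complex.log (diskToHalf F)).im| < γ * (Real.pi / 2) := by
  rw [Complex.im_ofReal_mul, abs_mul, abs_of_pos hγ0]
  exact mul_lt_mul_of_pos_left (abs_im_log_lt (diskToHalf_re_pos hF)) hγ0

lemma exp_re_pos {ℓ : ℂ} (h : |ℓ.im| < Real.pi / 2) : 0 < (Complex.exp ℓ).re := by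
  rw [Complex.exp_re]
  exact mul_pos (Real.exp_pos _) (Real.cos_pos_of_mem_Ioo (abs_lt.1 h))

lemma sectorMap_re_pos {γ : ℝ} (hγ0 : 0 < γ) (hγ1 : γ ≤ 1) {F : ℂ} (hF : ‖F‖ < 1) :
    0 < (sectorMap γ F).re := by
  refine exp_re_pos ((abs_im_sectorMap_log_lt hγ0 hF).trans_le ?_)
  nlinarith [Real.pi_pos]

lemma log_exp_of_abs_im_lt {ℓ : ℂ} (h : |ℓ.im| < Real.pi) : Complex.log (Complex.exp ℓ) = ℓ :=
  Complex.log_exp (abs_lt.1 h).1 (abs_lt.1 h).2.le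

lemma log_sectorMap {γ : ℝ} (hγ0 : 0 < γ) (hγ1 : γ ≤ 1) {F : ℂ} (hF : ‖F‖ < 1) :
    Complex.log (sectorMap γ F) = γ * Complex.log (diskToHalf F) := by
  refine log_exp_of_abs_im_lt ((abs_im_sectorMap_log_lt hγ0 hF).trans_le ?_)
  nlinarith [Real.pi_pos]

lemma sectorMap_neg {γ : ℝ} {F : ℂ} (hF : ‖F‖ < 1) :
    sectorMap γ (-F) = (sectorMap γ F)⁻¹ := by
  have harg : (diskToHalf F).arg ≠ Real.pi := by
    have := abs_im_log_lt (diskToHalf_re_pos hF)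
    rw [Complex.log_im] at this
    have h2 := Real.pi_pos
    intro h
    rw [h, abs_of_pos h2] at this
    linarith
  rw [sectorMap, sectorMap, diskToHalf_neg, Complex.log_inv _ harg, mul_neg, Complex.exp_neg]

lemma sectorMap_injOn {γ : ℝ} (hγ0 : 0 < γ) (hγ1 : γ ≤ 1) :
    Set.InjOn (sectorMap γ) (Metric.ball 0 1) := by
  intro F hF F' hF' h
  rw [mem_ball_zero_iff] at hF hF'
  have h1 := congrArg Complex.log h
  rw [log_sectorMap hγ0 hγ1 hF, log_sectorMap hγ0 hγ1 hF'] at h1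
  have h2 := mul_left_cancel₀ (by exact_mod_cast hγ0.ne') h1
  have h3 := congrArg Complex.exp h2
  rw [Complex.exp_log (diskToHalf_ne_zero hF), Complex.exp_log (diskToHalf_ne_zero hF')] at h3
  rw [← halfToDisk_diskToHalf hF, h3, halfToDisk_diskToHalf hF']

lemma hasDerivAt_sectorMap (γ : ℝ) {F : ℂ} (hF : ‖F‖ < 1) :
    HasDerivAt (sectorMap γ) (sectorMap γ F * (γ * (2 / ((1 - F) * (1 + F))))) F := by
  have h1 := one_sub_ne_zero_of_norm_lt hF
  have h2 := one_add_ne_zero_of_norm_lt hF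
  have hd : HasDerivAt diskToHalf ((1 * (1 - F) - (1 + F) * -1) / (1 - F) ^ 2) F :=
    ((hasDerivAt_id F).const_add 1).div ((hasDerivAt_id F).const_sub 1) h1
  have hs := Complex.mem_slitPlane_iff.2 (Or.inl (diskToHalf_re_pos hF))
  refine ((hd.clog hs).const_mul (γ : ℂ)).cexp.congr_deriv ?_
  change sectorMap γ F * _ = _
  congr 2
  rw [diskToHalf]
  field_simp
  ring

/-- Conformal map from the unit disk onto the symmetric lens with vertices `±1` and opening
angle `γ π`. -/
def lensMap (γ : ℝ) (F : ℂ) : ℂ := (sectorMap γ F - 1) / (sectorMap γ F + 1)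

lemma norm_lensMap_lt {γ : ℝ} (hγ0 : 0 < γ) (hγ1 : γ ≤ 1) {F : ℂ} (hF : ‖F‖ < 1) :
    ‖lensMap γ F‖ < 1 :=
  norm_halfToDisk_lt (sectorMap_re_pos hγ0 hγ1 hF)

lemma hasDerivAt_lensMap {γ : ℝ} (hγ0 : 0 < γ) (hγ1 : γ ≤ 1) {F : ℂ} (hF : ‖F‖ < 1) :
    HasDerivAt (lensMap γ) (4 * γ * sectorMap γ F /
      ((sectorMap γ F + 1) ^ 2 * ((1 - F) * (1 + F)))) F := by
  have h0 := one_add_ne_zero_of_re_pos (sectorMap_re_pos hγ0 hγ1 hF)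
  have h1 := one_sub_ne_zero_of_norm_lt hF
  have h2 := one_add_ne_zero_of_norm_lt hF
  have hd := hasDerivAt_sectorMap γ hF
  refine ((hd.sub_const 1).div (hd.add_const 1) h0).congr_deriv ?_
  field_simp
  ring

lemma isOddChart_lensMap {γ : ℝ} (hγ0 : 0 < γ) (hγ1 : γ ≤ 1) {Λ : ℂ} (hΛ : Λ ≠ 0) :
    IsOddChart fun F => Λ * lensMap γ F where
  diff F hF := ((hasDerivAt_lensMap hγ0 hγ1
    (mem_ball_zero_iff.1 hF)).const_mul Λ).differentiableAt.differentiableWithinAt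
  inj F hF F' hF' h := by
    have h1 := mul_left_cancel₀ hΛ h
    have h2 := congrArg diskToHalf h1
    rw [lensMap, lensMap,
      diskToHalf_halfToDisk (sectorMap_re_pos hγ0 hγ1 (mem_ball_zero_iff.1 hF)),
      diskToHalf_halfToDisk (sectorMap_re_pos hγ0 hγ1 (mem_ball_zero_iff.1 hF'))] at h2
    exact sectorMap_injOn hγ0 hγ1 hF hF' h2
  deriv_ne F hF := by
    rw [mem_ball_zero_iff] at hF
    have h0 := one_add_ne_zero_of_re_pos (sectorMap_re_pos hγ0 hγ1 hF)
    have h1 := one_sub_ne_zero_of_norm_lt hF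
    have h2 := one_add_ne_zero_of_norm_lt hF
    have h3 : (γ : ℂ) ≠ 0 := by exact_mod_cast hγ0.ne'
    rw [((hasDerivAt_lensMap hγ0 hγ1 hF).const_mul Λ).deriv]
    have h4 : sectorMap γ F ≠ 0 := Complex.exp_ne_zero _
    exact mul_ne_zero hΛ (div_ne_zero (mul_ne_zero (mul_ne_zero (by norm_num) h3) h4)
      (mul_ne_zero (pow_ne_zero 2 h0) (mul_ne_zero h1 h2)))
  odd F hF := by
    rw [mem_ball_zero_iff] at hF
    have h0 := one_add_ne_zero_of_re_pos (sectorMap_re_pos hγ0 hγ1 hF)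
    have h4 : sectorMap γ F ≠ 0 := Complex.exp_ne_zero _
    have h5 : (sectorMap γ F)⁻¹ + 1 ≠ 0 := by
      have : (sectorMap γ F)⁻¹ + 1 = (sectorMap γ F + 1) / sectorMap γ F := by
        field_simp
        ring
      rw [this]
      exact div_ne_zero h0 h4
    rw [lensMap, lensMap, sectorMap_neg hF, ← mul_neg, ← neg_div]
    congr 1
    rw [div_eq_div_iff h5 h0]
    field_simp
    ring

/-- The power combination in the Hardy weight, evaluated through the chart. -/
lemma cpow_sub_cpow_lensMap {γ : ℝ} (hγ0 : 0 < γ) (hγ1 : γ ≤ 1) {F : ℂ} (hF : ‖F‖ < 1) :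
    (1 + lensMap γ F) ^ ((1 + 1 / γ : ℝ) : ℂ) * (1 - lensMap γ F) ^ ((1 - 1 / γ : ℝ) : ℂ) -
      (1 - lensMap γ F) ^ ((1 + 1 / γ : ℝ) : ℂ) * (1 + lensMap γ F) ^ ((1 - 1 / γ : ℝ) : ℂ) =
    4 / γ * (F * deriv (lensMap γ) F) := by
  set z := lensMap γ F with hz
  set w := sectorMap γ F with hw
  have hz1 : ‖z‖ < 1 := norm_lensMap_lt hγ0 hγ1 hF
  have hwre : 0 < w.re := sectorMap_re_pos hγ0 hγ1 hF
  have hw1 := one_add_ne_zero_of_re_pos hwre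
  have hw0 : w ≠ 0 := Complex.exp_ne_zero _
  have hF1 := one_sub_ne_zero_of_norm_lt hF
  have hF2 := one_add_ne_zero_of_norm_lt hF
  have hγ : (γ : ℂ) ≠ 0 := by exact_mod_cast hγ0.ne'
  have hzw : z = (w - 1) / (w + 1) := rfl
  have ha0 : 1 + z ≠ 0 := one_add_ne_zero_of_norm_lt hz1
  have hb0 : 1 - z ≠ 0 := one_sub_ne_zero_of_norm_lt hz1
  have hre : |z.re| < 1 := (Complex.abs_re_le_norm z).trans_lt hz1
  have hlog : Complex.log (1 + z) - Complex.log (1 - z) = γ * Complex.log (diskToHalf F) := by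
    have h1 : |(Complex.log (1 + z)).im| < Real.pi / 2 :=
      abs_im_log_lt (by simp; linarith [(abs_lt.1 hre).1])
    have h2 : |(Complex.log (1 - z)).im| < Real.pi / 2 :=
      abs_im_log_lt (by simp; linarith [(abs_lt.1 hre).2])
    rw [← log_sectorMap hγ0 hγ1 hF, ← log_exp_of_abs_im_lt
      (ℓ := Complex.log (1 + z) - Complex.log (1 - z)), Complex.exp_sub, Complex.exp_log ha0,
      Complex.exp_log hb0]
    · congr 1
      exact diskToHalf_halfToDisk hwre
    · rw [Complex.sub_im]
      exact (abs_sub _ _).trans_lt (by linarith)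
  have hprod : ∀ s : ℂ, (1 + z) ^ (1 + s / γ) * (1 - z) ^ (1 - s / γ) =
      (1 + z) * (1 - z) * Complex.exp (s * Complex.log (diskToHalf F)) := by
    intro s
    rw [Complex.cpow_def_of_ne_zero ha0, Complex.cpow_def_of_ne_zero hb0, ← Complex.exp_add]
    conv_rhs => rw [← Complex.exp_log ha0, ← Complex.exp_log hb0]
    rw [← Complex.exp_add, ← Complex.exp_add]
    congr 1
    have : Complex.log (diskToHalf F) = (Complex.log (1 + z) - Complex.log (1 - z)) / γ := by
      rw [hlog]
      field_simp
    rw [this]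
    ring
  have hp1 := hprod 1
  have hp2 := hprod (-1)
  rw [one_mul, Complex.exp_log (diskToHalf_ne_zero hF)] at hp1
  rw [neg_one_mul, Complex.exp_neg, Complex.exp_log (diskToHalf_ne_zero hF), neg_div,
    ← sub_eq_add_neg, sub_neg_eq_add, mul_comm ((1 + z) ^ _)] at hp2
  push_cast
  rw [hp1, hp2, (hasDerivAt_lensMap hγ0 hγ1 hF).deriv, hzw, diskToHalf, ← hw]
  field_simp
  ring

/-- Opening parameter of the lens of relative coordinates with rescaled centre of mass `R`. -/
def lensExponent (R : ℝ) : ℝ := 1 - 2 / Real.pi * Real.arcsin R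

lemma lensExponent_mul_pi_div_two (R : ℝ) :
    lensExponent R * (Real.pi / 2) = Real.pi / 2 - Real.arcsin R := by
  rw [lensExponent]
  field_simp

lemma lensExponent_pos {R : ℝ} (hR : R < 1) : 0 < lensExponent R := by
  have h := lensExponent_mul_pi_div_two R
  have h2 := Real.arcsin_lt_pi_div_two.2 hR
  have h3 := Real.pi_pos
  by_contra! h4
  nlinarith

lemma lensExponent_le_one {R : ℝ} (hR : 0 ≤ R) : lensExponent R ≤ 1 := by
  have h2 := Real.arcsin_nonneg.2 hR
  have h3 := Real.pi_pos
  have : 0 ≤ 2 / Real.pi * Real.arcsin R := by positivity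
  rw [lensExponent]
  linarith

/-- Angular description of the sector obtained from the lens. -/
lemma mul_abs_im_lt_iff {R : ℝ} (hR0 : 0 ≤ R) (hR : R < 1) {w : ℂ} (hw : 0 < w.re) :
    R * |w.im| < Real.sqrt (1 - R ^ 2) * w.re ↔
      |(Complex.log w).im| < lensExponent R * (Real.pi / 2) := by
  have hw0 : w ≠ 0 := fun h => by simp [h] at hw
  have habs := abs_im_log_lt hw
  have hn : 0 < ‖w‖ := norm_pos_iff.2 hw0
  have hβ0 := Real.arcsin_nonneg.2 hR0
  have hβ1 := Real.arcsin_lt_pi_div_two.2 hR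
  have hsin : Real.sin (Real.arcsin R) = R := Real.sin_arcsin (by linarith) hR.le
  rw [lensExponent_mul_pi_div_two, ← Real.cos_arcsin]
  have hre : w.re = ‖w‖ * Real.cos |(Complex.log w).im| := by
    rw [Real.cos_abs, Complex.log_im, Complex.norm_mul_cos_arg]
  have him : |w.im| = ‖w‖ * Real.sin |(Complex.log w).im| := by
    rw [← Real.abs_sin_eq_sin_abs_of_abs_le_pi (habs.le.trans (by linarith [Real.pi_pos])),
      Complex.log_im, ← abs_norm w, ← abs_mul, Complex.norm_mul_sin_arg]
  have hθ0 := abs_nonneg (Complex.log w).im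
  generalize |(Complex.log w).im| = θ at *
  generalize Real.arcsin R = β at *
  rw [hre, him, ← hsin]
  have key : Real.cos β * (‖w‖ * Real.cos θ) - Real.sin β * (‖w‖ * Real.sin θ) =
      ‖w‖ * Real.cos (θ + β) := by
    rw [Real.cos_add]
    ring
  constructor
  · intro h
    by_contra! h2
    have h3 := Real.cos_nonpos_of_pi_div_two_le_of_le (x := θ + β) (by linarith) (by linarith)
    nlinarith
  · intro h
    have h3 := Real.cos_pos_of_mem_Ioo (x := θ + β) ⟨by linarith, by linarith⟩
    have := mul_pos hn h3
    linarith

/-- Rotation aligning the relative coordinate with the centre of mass. -/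
def lensRot (R' : ℂ) : ℂ := if ‖R'‖ = 0 then 1 else -Complex.I * (R' / ‖R'‖)

lemma norm_lensRot (R' : ℂ) : ‖lensRot R'‖ = 1 := by
  rw [lensRot]
  split_ifs with h
  · simp
  · simp [h]

lemma I_mul_norm_mul_lensRot (R' : ℂ) : Complex.I * ‖R'‖ * lensRot R' = R' := by
  rw [lensRot]
  split_ifs with h
  · simp [norm_eq_zero.1 h]
  · have : (‖R'‖ : ℂ) ≠ 0 := by exact_mod_cast h
    field_simp
    rw [Complex.I_sq]
    ring

lemma hardyF_eq {R' : ℂ} (hR : ‖R'‖ < 1) {F : ℂ} (hF : ‖F‖ < 1) :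
    hardyF R' (lensRot R' * lensMap (lensExponent ‖R'‖) F) =
      ((1 - ‖R'‖ ^ 2) * (‖F‖ * ‖deriv (lensMap (lensExponent ‖R'‖)) F‖) ^ 2)⁻¹ := by
  have hγ0 := lensExponent_pos hR
  have hγ1 := lensExponent_le_one (norm_nonneg R')
  have hz : (if ‖R'‖ = 0 then lensRot R' * lensMap (lensExponent ‖R'‖) F else
      Complex.I * (starRingEnd ℂ R' / (‖R'‖ : ℂ)) *
        (lensRot R' * lensMap (lensExponent ‖R'‖) F)) = lensMap (lensExponent ‖R'‖) F := by
    rw [lensRot]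
    split_ifs with h
    · simp
    · have h1 : (‖R'‖ : ℂ) ≠ 0 := by exact_mod_cast h
      have h2 : starRingEnd ℂ R' * R' = (‖R'‖ : ℂ) ^ 2 := Complex.conj_mul' R'
      have h3 : Complex.I * (starRingEnd ℂ R' / (‖R'‖ : ℂ)) * (-Complex.I * (R' / ‖R'‖)) = 1 := by
        calc _ = -(Complex.I * Complex.I) * (starRingEnd ℂ R' * R') / (‖R'‖ : ℂ) ^ 2 := by
              field_simp
          _ = 1 := by rw [h2, Complex.I_mul_I]; field_simp
      rw [← mul_assoc, h3, one_mul]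
  have := cpow_sub_cpow_lensMap hγ0 hγ1 hF
  simp only [hardyF, hz]
  have hR2 : 0 < 1 - ‖R'‖ ^ 2 := by nlinarith [norm_nonneg R']
  change 16 / (lensExponent ‖R'‖ ^ 2 * (1 - ‖R'‖ ^ 2)) /
    ‖_ ^ ((1 + 1 / lensExponent ‖R'‖ : ℝ) : ℂ) * _ ^ ((1 - 1 / lensExponent ‖R'‖ : ℝ) : ℂ) -
    _ ^ ((1 + 1 / lensExponent ‖R'‖ : ℝ) : ℂ) * _ ^ ((1 - 1 / lensExponent ‖R'‖ : ℝ) : ℂ)‖ ^ 2 = _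
  rw [this, norm_mul, norm_mul, norm_div, Complex.norm_real, Real.norm_of_nonneg hγ0.le,
    Complex.norm_ofNat, div_mul_eq_mul_div, div_pow, mul_pow _ _ 2,
    div_div_eq_mul_div]
  generalize (‖F‖ * ‖deriv (lensMap (lensExponent ‖R'‖)) F‖) ^ 2 = D
  rcases eq_or_ne D 0 with rfl | hD
  · simp
  · field_simp
    norm_num

/-- In the rotated and scaled relative coordinate, both disk constraints are linear in the
half-plane picture. -/
lemma norm_add_norm_sub_lt_iff {R κ : ℝ} (hR0 : 0 ≤ R) (hκ0 : 0 < κ) (hκ : κ ^ 2 = 1 - R ^ 2)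
    {w : ℂ} (hw : 0 < w.re) :
    (‖Complex.I * R + κ * ((w - 1) / (w + 1))‖ < 1 ∧
      ‖Complex.I * R - κ * ((w - 1) / (w + 1))‖ < 1) ↔ R * |w.im| < κ * w.re := by
  have h0 := one_add_ne_zero_of_re_pos hw
  have hn : 0 < Complex.normSq (w + 1) := Complex.normSq_pos.2 h0
  have key : ∀ ε : ℝ, ε ^ 2 = 1 → (‖Complex.I * R + ε * (κ * ((w - 1) / (w + 1)))‖ < 1 ↔
      R * (ε * w.im) < κ * w.re) := by
    intro ε hε
    rw [← sq_lt_sq₀ (norm_nonneg _) zero_le_one, ← Complex.normSq_eq_norm_sq]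
    have : Complex.I * R + ε * (κ * ((w - 1) / (w + 1))) =
        (Complex.I * R * (w + 1) + ε * κ * (w - 1)) / (w + 1) := by field_simp
    rw [this, Complex.normSq_div, div_lt_iff₀ hn]
    have h2 : (1 : ℝ) ^ 2 * Complex.normSq (w + 1) -
        Complex.normSq (Complex.I * R * (w + 1) + ε * κ * (w - 1)) =
        4 * κ * (κ * w.re - R * (ε * w.im)) := by
      simp [Complex.normSq_apply]
      linear_combination -((w.re + 1) ^ 2 + w.im ^ 2) * hκ -
        κ ^ 2 * ((w.re - 1) ^ 2 + w.im ^ 2) * hε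
    constructor <;> intro h <;> nlinarith
  have h1 := key 1 (by norm_num)
  have h2 := key (-1) (by norm_num)
  simp only [Complex.ofReal_one, one_mul, Complex.ofReal_neg, neg_one_mul, ← sub_eq_add_neg]
    at h1 h2
  rw [h1, h2, ← abs_of_nonneg hR0, ← abs_mul, abs_lt, abs_of_nonneg hR0]
  constructor
  · rintro ⟨h3, h4⟩
    constructor <;> linarith
  · rintro ⟨h3, h4⟩
    constructor <;> linarith

/-- The relative coordinates allowed by the two disk constraints form a lens. -/
lemma image_lensMap {lam : ℝ} (hlam : 0 < lam) {X : ℂ} (hX : ‖X‖ < lam) :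
    (fun F => 2 * lam * Real.sqrt (1 - ‖X / lam‖ ^ 2) * lensRot (X / lam) *
        lensMap (lensExponent ‖X / lam‖) F) '' Metric.ball 0 1 =
      {y | ‖X + y / 2‖ < lam ∧ ‖X - y / 2‖ < lam} := by
  set R' : ℂ := X / lam with hR'
  have hlam' : (lam : ℂ) ≠ 0 := by exact_mod_cast hlam.ne'
  have hR : ‖R'‖ < 1 := by
    rw [hR', norm_div, Complex.norm_real, Real.norm_of_nonneg hlam.le, div_lt_one hlam]
    exact hX
  have hR0 := norm_nonneg R'
  have hpos : 0 < 1 - ‖R'‖ ^ 2 := by nlinarith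
  set κ := Real.sqrt (1 - ‖R'‖ ^ 2) with hκdef
  have hκ0 : 0 < κ := Real.sqrt_pos.2 hpos
  have hκ : κ ^ 2 = 1 - ‖R'‖ ^ 2 := Real.sq_sqrt hpos.le
  have hκ' : (κ : ℂ) ≠ 0 := by exact_mod_cast hκ0.ne'
  have hγ0 := lensExponent_pos hR
  have hγ1 := lensExponent_le_one hR0
  have hrot : lensRot R' ≠ 0 := norm_pos_iff.1 (by rw [norm_lensRot]; exact one_pos)
  have hXe : X = lam * lensRot R' * (Complex.I * ‖R'‖) := by
    have := I_mul_norm_mul_lensRot R'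
    have h2 : X = lam * R' := by rw [hR']; field_simp
    linear_combination h2 - lam * this
  have hmem : ∀ z : ℂ, (‖X + 2 * lam * κ * lensRot R' * z / 2‖ < lam ∧
      ‖X - 2 * lam * κ * lensRot R' * z / 2‖ < lam) ↔
      (‖Complex.I * ‖R'‖ + κ * z‖ < 1 ∧ ‖Complex.I * ‖R'‖ - κ * z‖ < 1) := by
    intro z
    have hs : ∀ v : ℂ, ‖lam * lensRot R' * v‖ < lam ↔ ‖v‖ < 1 := by
      intro v
      rw [norm_mul, norm_mul, norm_lensRot, Complex.norm_real, Real.norm_of_nonneg hlam.le, mul_one]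
      exact mul_lt_iff_lt_one_right hlam
    rw [← hs, ← hs, mul_add, mul_sub, ← hXe]
    congr! 4 <;> ring
  ext y
  simp only [Set.mem_image, mem_ball_zero_iff, Set.mem_ofPred_eq]
  constructor
  · rintro ⟨F, hF, rfl⟩
    rw [hmem, lensMap, norm_add_norm_sub_lt_iff hR0 hκ0 hκ (sectorMap_re_pos hγ0 hγ1 hF),
      mul_abs_im_lt_iff hR0 hR (sectorMap_re_pos hγ0 hγ1 hF), log_sectorMap hγ0 hγ1 hF]
    exact abs_im_sectorMap_log_lt hγ0 hF
  · intro hy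
    obtain ⟨z, rfl⟩ : ∃ z, y = 2 * lam * κ * lensRot R' * z :=
      ⟨y / (2 * lam * κ * lensRot R'), by field_simp⟩
    rw [hmem] at hy
    have hz : ‖z‖ < 1 := by
      have h1 := parallelogram_law_with_norm ℝ (Complex.I * (‖R'‖ : ℂ)) (κ * z)
      simp only [norm_mul, Complex.norm_I, Complex.norm_real, norm_norm,
        Real.norm_of_nonneg hκ0.le, one_mul] at h1
      have h2 := norm_nonneg (Complex.I * (‖R'‖ : ℂ) + κ * z)
      have h3 := norm_nonneg (Complex.I * (‖R'‖ : ℂ) - κ * z)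
      rw [← sq_lt_sq₀ (norm_nonneg _) zero_le_one]
      nlinarith [hy.1, hy.2, mul_lt_one_of_nonneg_of_lt_one_left h2 hy.1 hy.1.le,
        mul_lt_one_of_nonneg_of_lt_one_left h3 hy.2 hy.2.le, sq_nonneg (‖z‖)]
    have hw := diskToHalf_re_pos hz
    rw [← halfToDisk_diskToHalf hz, norm_add_norm_sub_lt_iff hR0 hκ0 hκ hw,
      mul_abs_im_lt_iff hR0 hR hw] at hy
    have hℓ : |(Complex.log (diskToHalf z) / lensExponent ‖R'‖).im| < Real.pi / 2 := by
      rw [Complex.div_ofReal_im, abs_div, abs_of_pos hγ0, div_lt_iff₀ hγ0, mul_comm]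
      exact hy
    have hW := exp_re_pos hℓ
    refine ⟨_, norm_halfToDisk_lt hW, ?_⟩
    have hγ' : (lensExponent ‖R'‖ : ℂ) ≠ 0 := by exact_mod_cast hγ0.ne'
    rw [lensMap, sectorMap, diskToHalf_halfToDisk hW,
      log_exp_of_abs_im_lt (hℓ.trans (by linarith [Real.pi_pos])), mul_div_cancel₀ _ hγ',
      Complex.exp_log (diskToHalf_ne_zero hz), halfToDisk_diskToHalf hz]

/-- The Hardy weight of a pair of particles at `a` and `b`. -/
def pairWeight (lam : ℝ) (a b : ℂ) : ℝ :=
  hardyF ((a + b) / ((2 * lam : ℝ) : ℂ))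
    ((a - b) / ((2 * lam * Real.sqrt (1 - ‖(a + b) / ((2 * lam : ℝ) : ℂ)‖ ^ 2) : ℝ) : ℂ))

/-- Hardy inequality in the relative coordinate at fixed centre of mass `X`. -/
lemma relative_hardy {ι : Type*} {s : Finset ι} {Y : ι → ℂ} {α c lam : ℝ} {U : ℂ → ℂ}
    (hlam : 0 < lam) (hc0 : 0 ≤ c)
    (hc : ∀ p : ℕ, p ≤ s.card → ∀ q : ℤ, c ≤ |(2 * (p : ℝ) + 1) * α - 2 * q|)
    (hU : ContDiff ℝ 1 U) (heven : ∀ y, U (-y) = U y) (X : ℂ) :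
    ∫⁻ y in {y | ‖X + y / 2‖ < lam ∧ ‖X - y / 2‖ < lam},
        ENNReal.ofReal (c ^ 2 * (pairWeight lam (X + y / 2) (X - y / 2) / (4 * lam ^ 2) *
          ‖U y‖ ^ 2)) ≤
      ∫⁻ y in {y | ‖X + y / 2‖ < lam ∧ ‖X - y / 2‖ < lam},
        ENNReal.ofReal (‖relCov α (relGauge s Y) U y 1‖ ^ 2 +
          ‖relCov α (relGauge s Y) U y Complex.I‖ ^ 2) := by
  rcases le_or_gt lam ‖X‖ with hX | hX
  · have : {y : ℂ | ‖X + y / 2‖ < lam ∧ ‖X - y / 2‖ < lam} = ∅ := by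
      refine Set.eq_empty_of_forall_notMem fun y hy => ?_
      have h1 : ‖(X + y / 2) + (X - y / 2)‖ = 2 * ‖X‖ := by
        rw [add_add_sub_cancel, ← two_mul, norm_mul, Complex.norm_ofNat]
      have h2 := norm_add_le (X + y / 2) (X - y / 2)
      linarith [hy.1, hy.2]
    simp [this]
  · have hlam' : (lam : ℂ) ≠ 0 := by exact_mod_cast hlam.ne'
    have hR : ‖X / lam‖ < 1 := by
      rw [norm_div, Complex.norm_real, Real.norm_of_nonneg hlam.le, div_lt_one hlam]
      exact hX
    have hpos : 0 < 1 - ‖X / lam‖ ^ 2 := by nlinarith [norm_nonneg (X / (lam : ℂ))]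
    have hκ := Real.sq_sqrt hpos.le
    have hκ0 := Real.sqrt_pos.2 hpos
    set κ := Real.sqrt (1 - ‖X / lam‖ ^ 2) with hκdef
    have hκ' : (κ : ℂ) ≠ 0 := by exact_mod_cast hκ0.ne'
    have hγ0 := lensExponent_pos hR
    have hγ1 := lensExponent_le_one (norm_nonneg (X / (lam : ℂ)))
    have hrot : lensRot (X / lam) ≠ 0 :=
      norm_pos_iff.1 (by rw [norm_lensRot]; exact one_pos)
    have hΛ : 2 * lam * κ * lensRot (X / lam) ≠ 0 :=
      mul_ne_zero (mul_ne_zero (mul_ne_zero two_ne_zero hlam') hκ') hrot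
    have hΛn : ‖2 * lam * κ * lensRot (X / lam)‖ = 2 * lam * κ := by
      simp only [norm_mul, norm_lensRot, Complex.norm_real, Real.norm_of_nonneg hlam.le,
        Real.norm_of_nonneg hκ0.le, Complex.norm_ofNat, mul_one]
    have hG := isOddChart_lensMap hγ0 hγ1 hΛ
    rw [← image_lensMap hlam hX]
    refine IsOddChart.hardy hG (W := fun y => pairWeight lam (X + y / 2) (X - y / 2) /
      (4 * lam ^ 2)) ?_ hc0 hc hU heven
    intro F hF hF0
    have hF1 := mem_ball_zero_iff.1 hF
    have hd := (hasDerivAt_lensMap hγ0 hγ1 hF1).differentiableAt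
    have hne : deriv (fun F => 2 * lam * κ * lensRot (X / lam) *
      lensMap (lensExponent ‖X / lam‖) F) F ≠ 0 := hG.deriv_ne F hF
    rw [deriv_const_mul _ hd] at hne ⊢
    have hne2 : 0 < ‖deriv (lensMap (lensExponent ‖X / lam‖)) F‖ :=
      norm_pos_iff.2 (right_ne_zero_of_mul hne)
    have hFn : 0 < ‖F‖ := norm_pos_iff.2 hF0
    have e1 : ∀ y : ℂ, (X + y / 2 + (X - y / 2)) / ((2 * lam : ℝ) : ℂ) = X / lam := by
      intro y
      push_cast
      field_simp
      ring
    have e2 : (X + 2 * lam * κ * lensRot (X / lam) * lensMap (lensExponent ‖X / lam‖) F / 2 -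
        (X - 2 * lam * κ * lensRot (X / lam) * lensMap (lensExponent ‖X / lam‖) F / 2)) /
        ((2 * lam * κ : ℝ) : ℂ) = lensRot (X / lam) * lensMap (lensExponent ‖X / lam‖) F := by
      push_cast
      field_simp
      ring
    simp only [pairWeight, e1, ← hκdef, e2]
    rw [hardyF_eq hR hF1, norm_mul, hΛn, ← hκ]
    field_simp
    norm_num

lemma lintegral_lintegral_centre {Φ : ℂ → ℂ → ENNReal} (hΦ : Measurable (Function.uncurry Φ)) :
    ∫⁻ a, ∫⁻ b, Φ a b = ∫⁻ X, ∫⁻ y, Φ (X + y / 2) (X - y / 2) := by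
  have h1 : ∀ a : ℂ, ∫⁻ b, Φ a b = ∫⁻ y, Φ a (a - y) := fun a =>
    (lintegral_sub_left_eq_self (fun b => Φ a b) a).symm
  have h2 : ∀ y : ℂ, ∫⁻ a, Φ a (a - y) = ∫⁻ X, Φ (X + y / 2) (X - y / 2) := by
    intro y
    rw [← lintegral_add_right_eq_self (fun a => Φ a (a - y)) (y / 2)]
    refine lintegral_congr fun X => ?_
    congr 1
    ring
  simp_rw [h1]
  rw [lintegral_lintegral_swap, lintegral_congr h2, lintegral_lintegral_swap]
  · exact (hΦ.comp (f := fun p : ℂ × ℂ => (p.2 + p.1 / 2, p.2 - p.1 / 2))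
      (by fun_prop)).aemeasurable
  · exact (hΦ.comp (f := fun p : ℂ × ℂ => (p.1, p.1 - p.2)) (by fun_prop)).aemeasurable

/-- An inequality in the relative coordinate integrates to one over the product of two disks. -/
lemma lintegral_disk_disk_le {lam : ℝ} {Φ Ψ : ℂ → ℂ → ENNReal}
    (hΦ : Measurable (Function.uncurry Φ)) (hΨ : Measurable (Function.uncurry Ψ))
    (h : ∀ X : ℂ, ∫⁻ y in {y | ‖X + y / 2‖ < lam ∧ ‖X - y / 2‖ < lam},
        Φ (X + y / 2) (X - y / 2) ≤
      ∫⁻ y in {y | ‖X + y / 2‖ < lam ∧ ‖X - y / 2‖ < lam}, Ψ (X + y / 2) (X - y / 2)) :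
    ∫⁻ a in Metric.ball 0 lam, ∫⁻ b in Metric.ball 0 lam, Φ a b ≤
      ∫⁻ a in Metric.ball 0 lam, ∫⁻ b in Metric.ball 0 lam, Ψ a b := by
  have hL : ∀ X : ℂ, MeasurableSet {y : ℂ | ‖X + y / 2‖ < lam ∧ ‖X - y / 2‖ < lam} := by
    intro X
    have h1 : MeasurableSet {y : ℂ | ‖X + y / 2‖ < lam} :=
      measurableSet_lt (by fun_prop) measurable_const
    have h2 : MeasurableSet {y : ℂ | ‖X - y / 2‖ < lam} :=
      measurableSet_lt (by fun_prop) measurable_const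
    exact h1.inter h2
  have key : ∀ Θ : ℂ → ℂ → ENNReal, Measurable (Function.uncurry Θ) →
      ∫⁻ a in Metric.ball 0 lam, ∫⁻ b in Metric.ball 0 lam, Θ a b =
        ∫⁻ X, ∫⁻ y in {y | ‖X + y / 2‖ < lam ∧ ‖X - y / 2‖ < lam},
          Θ (X + y / 2) (X - y / 2) := by
    intro Θ hΘ
    have h1 : ∫⁻ a in Metric.ball 0 lam, ∫⁻ b in Metric.ball 0 lam, Θ a b =
        ∫⁻ a, ∫⁻ b, (Metric.ball (0 : ℂ) lam ×ˢ Metric.ball (0 : ℂ) lam).indicator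
          (Function.uncurry Θ) (a, b) := by
      rw [← lintegral_indicator measurableSet_ball]
      refine lintegral_congr fun a => ?_
      by_cases ha : a ∈ Metric.ball (0 : ℂ) lam
      · rw [Set.indicator_of_mem ha, ← lintegral_indicator measurableSet_ball]
        refine lintegral_congr fun b => ?_
        by_cases hb : b ∈ Metric.ball (0 : ℂ) lam
        · rw [Set.indicator_of_mem hb, Set.indicator_of_mem (Set.mk_mem_prod ha hb)]
          rfl
        · rw [Set.indicator_of_notMem hb, Set.indicator_of_notMem fun h => hb h.2]
      · rw [Set.indicator_of_notMem ha]
        simp [ha]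
    rw [h1, lintegral_lintegral_centre (Φ := fun a b =>
      (Metric.ball (0 : ℂ) lam ×ˢ Metric.ball (0 : ℂ) lam).indicator (Function.uncurry Θ) (a, b))
      (hΘ.indicator (measurableSet_ball.prod measurableSet_ball))]
    refine lintegral_congr fun X => ?_
    rw [← lintegral_indicator (hL X)]
    refine lintegral_congr fun y => ?_
    simp only [Set.indicator, Set.mem_prod, mem_ball_zero_iff, Set.mem_ofPred_eq,
      Function.uncurry]
  rw [key Φ hΦ, key Ψ hΨ]
  exact lintegral_mono h

lemma lintegral_pi_le_of_pair {ι : Type*} [Fintype ι] [DecidableEq ι] {i j : ι} (hij : i ≠ j)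
    (Ω : Set ℂ) {f g : (ι → ℂ) → ENNReal} (hf : Measurable f) (hg : Measurable g)
    (h : ∀ x : ι → ℂ,
      ∫⁻ a in Ω, ∫⁻ b in Ω, f (Function.update (Function.update x i a) j b) ≤
        ∫⁻ a in Ω, ∫⁻ b in Ω, g (Function.update (Function.update x i a) j b)) :
    ∫⁻ x in Set.univ.pi fun _ : ι => Ω, f x ≤ ∫⁻ x in Set.univ.pi fun _ : ι => Ω, g x := by
  rw [volume_pi, Measure.restrict_pi_pi]
  refine lintegral_le_of_lmarginal_le {i, j} hf hg fun x => ?_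
  have hij' : i ∉ ({j} : Finset ι) := by simpa using hij
  rw [lmarginal_insert _ hf hij', lmarginal_insert _ hg hij', lmarginal_singleton,
    lmarginal_singleton]
  exact h x

/-- The covariant derivative `D_j u` in the direction `h`. -/
def covDeriv (α : ℝ) {N : ℕ} (u : (Fin N → ℂ) → ℂ) (j : Fin N) (h : ℂ) (x : Fin N → ℂ) : ℂ :=
  -Complex.I * fderiv ℝ u x (Pi.single j h) +
    ((α * ∑ k ∈ Finset.univ.erase j, (h / (x j - x k)).im : ℝ) : ℂ) * u x

lemma covSq_eq (α : ℝ) {N : ℕ} (u : (Fin N → ℂ) → ℂ) (j : Fin N) (x : Fin N → ℂ) :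
    covSq α u j x = ‖covDeriv α u j 1 x‖ ^ 2 + ‖covDeriv α u j Complex.I x‖ ^ 2 := by
  have h1 : ∀ d : ℂ, (Complex.I * d / (‖d‖ : ℂ) ^ 2).re = (1 / d).im := by
    intro d
    rw [← Complex.ofReal_pow, Complex.div_ofReal_re, ← Complex.normSq_eq_norm_sq, one_div,
      Complex.inv_im]
    simp
  have h2 : ∀ d : ℂ, (Complex.I * d / (‖d‖ : ℂ) ^ 2).im = (Complex.I / d).im := by
    intro d
    rw [← Complex.ofReal_pow, Complex.div_ofReal_im, ← Complex.normSq_eq_norm_sq,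
      Complex.div_im]
    simp
  simp only [covSq, covDeriv, Complex.re_ofReal_mul, Complex.im_ofReal_mul, Complex.re_sum,
    Complex.im_sum, h1, h2]

lemma measurable_covDeriv (α : ℝ) {N : ℕ} {u : (Fin N → ℂ) → ℂ} (hu : ContDiff ℝ 1 u)
    (j : Fin N) (h : ℂ) : Measurable (covDeriv α u j h) := by
  have h1 : Measurable fun x => fderiv ℝ u x (Pi.single j h) :=
    ((hu.continuous_fderiv one_ne_zero).clm_apply continuous_const).measurable
  have h2 : Measurable u := hu.continuous.measurable
  unfold covDeriv
  fun_prop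

lemma measurable_hardyF : Measurable (Function.uncurry hardyF) := by
  have hz : Measurable fun p : ℂ × ℂ => if ‖p.1‖ = 0 then p.2 else
      Complex.I * (starRingEnd ℂ p.1 / (‖p.1‖ : ℂ)) * p.2 := by
    refine Measurable.ite (measurableSet_eq_fun (by fun_prop) measurable_const)
      measurable_snd ?_
    have : Measurable fun p : ℂ × ℂ => starRingEnd ℂ p.1 :=
      (Complex.continuous_conj.comp continuous_fst).measurable
    fun_prop
  have hγ : Measurable fun p : ℂ × ℂ => 1 - 2 / Real.pi * Real.arcsin ‖p.1‖ := by
    have := Real.measurable_arcsin.comp (measurable_fst (α := ℂ) (β := ℂ)).norm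
    exact measurable_const.sub (measurable_const.mul this)
  unfold hardyF Function.uncurry
  dsimp only
  fun_prop

lemma measurable_pairWeight (lam : ℝ) : Measurable (Function.uncurry (pairWeight lam)) :=
  measurable_hardyF.comp (f := fun p : ℂ × ℂ => ((p.1 + p.2) / ((2 * lam : ℝ) : ℂ),
    (p.1 - p.2) / ((2 * lam * Real.sqrt (1 - ‖(p.1 + p.2) / ((2 * lam : ℝ) : ℂ)‖ ^ 2) : ℝ) : ℂ)))
    (by fun_prop)

lemma statC_nonneg (α : ℝ) (N : ℕ) : 0 ≤ statC α N :=
  Real.iInf_nonneg fun _ => Real.iInf_nonneg fun _ => abs_nonneg _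

lemma statC_le (α : ℝ) {N p : ℕ} (hp : p < N - 1) (q : ℤ) :
    statC α N ≤ |(2 * (p : ℝ) + 1) * α - 2 * q| := by
  refine (ciInf_le ⟨0, ?_⟩ (⟨p, hp⟩ : Fin (N - 1))).trans (ciInf_le ⟨0, ?_⟩ q)
  · rintro _ ⟨p, rfl⟩
    exact Real.iInf_nonneg fun _ => abs_nonneg _
  · rintro _ ⟨q, rfl⟩
    exact abs_nonneg _

/-- The relative covariant derivative of a pair, for fixed centre of mass `X`. -/
lemma norm_covDeriv_sub (α : ℝ) {N : ℕ} {u : (Fin N → ℂ) → ℂ} (hu : ContDiff ℝ 1 u)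
    {i j : Fin N} (hij : i ≠ j) (x : Fin N → ℂ) (X y h : ℂ) :
    ‖covDeriv α u i h (Function.update (Function.update x i (X + y / 2)) j (X - y / 2)) -
        covDeriv α u j h (Function.update (Function.update x i (X + y / 2)) j (X - y / 2))‖ =
      2 * ‖relCov α (relGauge ((Finset.univ.erase i).erase j) fun l => 2 * (x l - X))
        (fun y => u (Function.update (Function.update x i (X + y / 2)) j (X - y / 2))) y h‖ := by
  have hP : ∀ y : ℂ, Function.update (Function.update x i (X + y / 2)) j (X - y / 2) =
      Function.update (Function.update x i X) j X +
        (Pi.single i (y / 2) - Pi.single j (y / 2)) := by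
    intro y
    funext k
    by_cases hk : k = j
    · subst hk
      simp [hij.symm, sub_eq_add_neg]
    · by_cases hk' : k = i
      · subst hk'
        simp [hij]
      · simp [hk, hk']
  set L : ℂ →L[ℝ] (Fin N → ℂ) :=
    (ContinuousLinearMap.single ℝ (fun _ : Fin N => ℂ) i -
      ContinuousLinearMap.single ℝ (fun _ : Fin N => ℂ) j).comp
      ((2⁻¹ : ℝ) • ContinuousLinearMap.id ℝ ℂ) with hL
  have hLh : ∀ h : ℂ, L h = (2⁻¹ : ℝ) • (Pi.single i h - Pi.single j h) := by
    intro h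
    simp [hL, ← Pi.single_smul, smul_sub]
  have hLy : ∀ y : ℂ, L y = Pi.single i (y / 2) - Pi.single j (y / 2) := by
    intro y
    rw [hLh, smul_sub, ← Pi.single_smul, ← Pi.single_smul]
    congr 2 <;> simp <;> ring
  have hfd : fderiv ℝ (fun y => u (Function.update (Function.update x i (X + y / 2)) j
      (X - y / 2))) y h = 2⁻¹ *
        (fderiv ℝ u (Function.update (Function.update x i (X + y / 2)) j (X - y / 2))
          (Pi.single i h) -
        fderiv ℝ u (Function.update (Function.update x i (X + y / 2)) j (X - y / 2))
          (Pi.single j h)) := by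
    have hd : HasFDerivAt (fun y => Function.update (Function.update x i (X + y / 2)) j
        (X - y / 2)) L y := by
      simp_rw [hP, ← hLy]
      exact L.hasFDerivAt.const_add _
    have := ((hu.differentiable one_ne_zero _).hasFDerivAt.comp y hd).fderiv
    rw [Function.comp_def] at this
    rw [this, ContinuousLinearMap.comp_apply, hLh, map_smul, map_sub]
    simp
  set P := Function.update (Function.update x i (X + y / 2)) j (X - y / 2) with hPdef
  have hPi : P i = X + y / 2 := by simp [hPdef, hij]
  have hPj : P j = X - y / 2 := by simp [hPdef]
  have hPl : ∀ l ∈ (Finset.univ.erase i).erase j, P l = x l := by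
    intro l hl
    simp only [Finset.mem_erase] at hl
    simp [hPdef, hl.1, hl.2.1]
  have hhalf : ∀ v : ℂ, h / (v / 2) = (2 : ℝ) * (h * (1 / v)) := by
    intro v
    push_cast
    ring
  have hgauge : ∑ k ∈ Finset.univ.erase i, (h / (P i - P k)).im -
      ∑ k ∈ Finset.univ.erase j, (h / (P j - P k)).im =
      2 * (h * relGauge ((Finset.univ.erase i).erase j) (fun l => 2 * (x l - X)) y).im := by
    rw [← Finset.add_sum_erase (a := j) (s := Finset.univ.erase i) _ (by simp [hij.symm]),
      ← Finset.add_sum_erase (a := i) (s := Finset.univ.erase j) _ (by simp [hij]),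
      Finset.erase_right_comm (a := j) (b := i), relGauge, mul_add, Finset.mul_sum,
      Complex.add_im, Complex.im_sum, mul_add, Finset.mul_sum, add_sub_add_comm,
      ← Finset.sum_sub_distrib]
    congr 1
    · have e1 : h / (P i - P j) = h * (1 / y) := by
        rw [hPi, hPj]
        ring
      have e2 : h / (P j - P i) = -(h * (1 / y)) := by
        rw [hPi, hPj, ← neg_sub, div_neg]
        ring
      rw [e1, e2, Complex.neg_im]
      ring
    · refine Finset.sum_congr rfl fun l hl => ?_
      have e1 : P i - P l = (y - 2 * (x l - X)) / 2 := by
        rw [hPi, hPl l hl]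
        ring
      have e2 : P j - P l = -(y + 2 * (x l - X)) / 2 := by
        rw [hPj, hPl l hl]
        ring
      rw [e1, e2, neg_div, div_neg, hhalf, hhalf, Complex.neg_im, Complex.im_ofReal_mul,
        Complex.im_ofReal_mul, mul_add, Complex.add_im]
      ring
  have hfinal : covDeriv α u i h P - covDeriv α u j h P = -(2 * Complex.I) *
      relCov α (relGauge ((Finset.univ.erase i).erase j) fun l => 2 * (x l - X))
        (fun y => u (Function.update (Function.update x i (X + y / 2)) j (X - y / 2))) y h := by
    rw [relCov, hfd, covDeriv, covDeriv, ← hPdef]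
    have hg : ((α * (h * relGauge ((Finset.univ.erase i).erase j)
        (fun l => 2 * (x l - X)) y).im : ℝ) : ℂ) =
        2⁻¹ * (((α * ∑ k ∈ Finset.univ.erase i, (h / (P i - P k)).im : ℝ) : ℂ) -
          ((α * ∑ k ∈ Finset.univ.erase j, (h / (P j - P k)).im : ℝ) : ℂ)) := by
      rw [← Complex.ofReal_sub, ← mul_sub, hgauge]
      push_cast
      ring
    rw [hg]
    linear_combination -u P * (((α * ∑ k ∈ Finset.univ.erase i, (h / (P i - P k)).im : ℝ) : ℂ) -
          ((α * ∑ k ∈ Finset.univ.erase j, (h / (P j - P k)).im : ℝ) : ℂ)) * (-1) * Complex.I_sq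
  rw [hfinal, norm_mul, norm_neg, norm_mul, Complex.norm_I, Complex.norm_ofNat, mul_one]

/-- The Hardy inequality carried by a single pair of particles. -/
lemma pair_hardy (α : ℝ) {N : ℕ} {lam : ℝ} (hlam : 0 < lam) {u : (Fin N → ℂ) → ℂ}
    (hu : ContDiff ℝ 1 u) (hsymm : ∀ (σ : Equiv.Perm (Fin N)) (x : Fin N → ℂ), u (x ∘ σ) = u x)
    {i j : Fin N} (hij : i ≠ j) :
    ∫⁻ x in Set.univ.pi fun _ : Fin N => Metric.ball (0 : ℂ) lam,
        ENNReal.ofReal (statC α N ^ 2 / lam ^ 2 * (pairWeight lam (x i) (x j) * ‖u x‖ ^ 2)) ≤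
      ∫⁻ x in Set.univ.pi fun _ : Fin N => Metric.ball (0 : ℂ) lam,
        ENNReal.ofReal (‖covDeriv α u i 1 x - covDeriv α u j 1 x‖ ^ 2 +
          ‖covDeriv α u i Complex.I x - covDeriv α u j Complex.I x‖ ^ 2) := by
  have hD := fun (k : Fin N) (h : ℂ) => measurable_covDeriv α hu k h
  have hw : Measurable fun x : Fin N → ℂ => pairWeight lam (x i) (x j) :=
    (measurable_pairWeight lam).comp (f := fun x : Fin N → ℂ => (x i, x j)) (by fun_prop)
  have hum : Measurable u := hu.continuous.measurable
  have hf : Measurable fun x : Fin N → ℂ =>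
      ENNReal.ofReal (statC α N ^ 2 / lam ^ 2 * (pairWeight lam (x i) (x j) * ‖u x‖ ^ 2)) := by
    fun_prop
  have hg : Measurable fun x : Fin N → ℂ =>
      ENNReal.ofReal (‖covDeriv α u i 1 x - covDeriv α u j 1 x‖ ^ 2 +
          ‖covDeriv α u i Complex.I x - covDeriv α u j Complex.I x‖ ^ 2) := by
    fun_prop
  refine lintegral_pi_le_of_pair hij _ hf hg fun x => ?_
  have hupd : Measurable fun p : ℂ × ℂ =>
      Function.update (Function.update x i p.1) j p.2 := by
    refine measurable_pi_iff.2 fun k => ?_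
    by_cases hk : k = j
    · subst hk
      simpa using measurable_snd
    · by_cases hk' : k = i
      · subst hk'
        simpa [hk] using measurable_fst
      · simp [hk, hk']
  refine lintegral_disk_disk_le (hf.comp hupd) (hg.comp hupd) fun X => ?_
  set U : ℂ → ℂ := fun y => u (Function.update (Function.update x i (X + y / 2)) j (X - y / 2))
    with hUdef
  have hU : ContDiff ℝ 1 U := by
    refine hu.comp (contDiff_pi.2 fun k => ?_)
    by_cases hk : k = j
    · subst hk
      simp only [Function.update_self]
      fun_prop
    · by_cases hk' : k = i
      · subst hk'
        simp only [Function.update_of_ne hk, Function.update_self]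
        fun_prop
      · simp only [Function.update_of_ne hk, Function.update_of_ne hk']
        fun_prop
  have heven : ∀ y, U (-y) = U y := by
    intro y
    simp only [hUdef]
    rw [← hsymm (Equiv.swap i j)]
    congr 1
    funext k
    by_cases hk : k = j
    · subst hk
      simp [hij, neg_div, sub_eq_add_neg]
    · by_cases hk' : k = i
      · subst hk'
        simp [hij, neg_div]
      · simp [Equiv.swap_apply_of_ne_of_ne hk' hk, hk, hk']
  have hcard : ((Finset.univ.erase i).erase j).card + 1 < N := by
    rw [Finset.card_erase_add_one (by simp [hij.symm])]
    simpa using Finset.card_erase_lt_of_mem (Finset.mem_univ i)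
  have key := relative_hardy (s := (Finset.univ.erase i).erase j)
    (Y := fun l => 2 * (x l - X)) (α := α) hlam (statC_nonneg α N)
    (fun p hp q => statC_le α (by omega) q) hU heven X
  have key4 := mul_le_mul_right key (ENNReal.ofReal 4)
  rw [← lintegral_const_mul' _ _ ENNReal.ofReal_ne_top,
    ← lintegral_const_mul' _ _ ENNReal.ofReal_ne_top] at key4
  simp only [← ENNReal.ofReal_mul (zero_le_four : (0 : ℝ) ≤ 4)] at key4
  simp only [norm_covDeriv_sub α hu hij, Function.update_self, Function.update_of_ne hij, ← hUdef]
  convert key4 using 4 with y y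
  · simp only [hUdef]
    field_simp
  · ring

lemma sum_sum_lt_norm_sub_sq_le {N : ℕ} (d : Fin N → ℂ) :
    ∑ i, ∑ j, (if i < j then ‖d i - d j‖ ^ 2 else 0) ≤ N * ∑ j, ‖d j‖ ^ 2 := by
  have h1 : ∑ i, ∑ j, ‖d i - d j‖ ^ 2 = 2 * N * ∑ j, ‖d j‖ ^ 2 - 2 * ‖∑ j, d j‖ ^ 2 := by
    have e : ∀ i j, ‖d i - d j‖ ^ 2 =
        ‖d i‖ ^ 2 + ‖d j‖ ^ 2 - 2 * ((d i).re * (d j).re + (d i).im * (d j).im) := by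
      intro i j
      simp only [← Complex.normSq_eq_norm_sq, Complex.normSq_apply, Complex.sub_re, Complex.sub_im]
      ring
    have e2 : ‖∑ j, d j‖ ^ 2 = ∑ i, ∑ j, ((d i).re * (d j).re + (d i).im * (d j).im) := by
      rw [← Complex.normSq_eq_norm_sq, Complex.normSq_apply, Complex.re_sum, Complex.im_sum]
      simp only [Finset.sum_mul_sum, Finset.sum_add_distrib]
    rw [e2]
    simp only [e, Finset.sum_sub_distrib, Finset.sum_add_distrib, Finset.sum_const,
      Finset.card_univ, Fintype.card_fin, nsmul_eq_mul, ← Finset.mul_sum]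
    ring
  have h2 : ∑ i, ∑ j, ‖d i - d j‖ ^ 2 = 2 * ∑ i, ∑ j, if i < j then ‖d i - d j‖ ^ 2 else 0 := by
    have e : ∀ i j, ‖d i - d j‖ ^ 2 = (if i < j then ‖d i - d j‖ ^ 2 else 0) +
        if j < i then ‖d j - d i‖ ^ 2 else 0 := by
      intro i j
      rcases lt_trichotomy i j with h | rfl | h
      · simp [h, h.not_gt]
      · simp
      · simp [h, h.not_gt, norm_sub_rev]
    calc _ = ∑ i, ∑ j, ((if i < j then ‖d i - d j‖ ^ 2 else 0) +
        if j < i then ‖d j - d i‖ ^ 2 else 0) :=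
          Finset.sum_congr rfl fun i _ => Finset.sum_congr rfl fun j _ => e i j
      _ = _ := by
        simp only [Finset.sum_add_distrib]
        rw [Finset.sum_comm (f := fun i j => if j < i then ‖d j - d i‖ ^ 2 else 0)]
        ring
  nlinarith [sq_nonneg ‖∑ j, d j‖]

lemma ofReal_sum_le {ι : Type*} (s : Finset ι) (f : ι → ℝ) :
    ENNReal.ofReal (∑ i ∈ s, f i) ≤ ∑ i ∈ s, ENNReal.ofReal (f i) :=
  Finset.le_sum_of_subadditive _ ENNReal.ofReal_zero.le (fun _ _ => ENNReal.ofReal_add_le) s f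

/-- **Theorem (many-anyon Hardy inequality on a disk).** For the disk `Ω = B_λ(0)` and an
`N`-anyon wave function `u`,
`∫_{Ω^N} ∑_j |D_j u|² ≥ (C_{α,N}²/(Nλ²)) ∫_{Ω^N} ∑_{i<j} f((x_i+x_j)/2λ, (x_i−x_j)/(2λ√(1−R²))) |u|²`. -/
theorem many_anyon_hardy_disk (α : ℝ) (N : ℕ) (hN : 2 ≤ N) (lam : ℝ) (hlam : 0 < lam)
    (Ω : Set ℂ) (hΩ : Ω = Metric.ball (0 : ℂ) lam)
    (u : (Fin N → ℂ) → ℂ) (hu : IsAnyonWF N u) :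
    ENNReal.ofReal (statC α N ^ 2 / ((N : ℝ) * lam ^ 2)) *
        ∫⁻ x in Set.univ.pi (fun _ : Fin N => Ω),
          ENNReal.ofReal (∑ i : Fin N, ∑ j : Fin N, if i < j then
            hardyF ((x i + x j) / ((2 * lam : ℝ) : ℂ))
              ((x i - x j) /
                ((2 * lam * Real.sqrt (1 - ‖(x i + x j) / ((2 * lam : ℝ) : ℂ)‖ ^ 2) : ℝ) : ℂ)) *
              ‖u x‖ ^ 2
            else 0) ≤
      ∫⁻ x in Set.univ.pi (fun _ : Fin N => Ω),
        ENNReal.ofReal (∑ j : Fin N, covSq α u j x) := by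
  subst hΩ
  have hu1 : ContDiff ℝ 1 u := hu.smooth.of_le (by exact_mod_cast le_top)
  have hN0 : (0 : ℝ) < N := by
    have : 0 < N := by omega
    exact_mod_cast this
  have hD := fun (k : Fin N) (h : ℂ) => measurable_covDeriv α hu1 k h
  have hw : ∀ i j, Measurable fun x : Fin N → ℂ => pairWeight lam (x i) (x j) := fun i j =>
    (measurable_pairWeight lam).comp (f := fun x : Fin N → ℂ => (x i, x j)) (by fun_prop)
  have hum : Measurable u := hu1.continuous.measurable
  let Φ : Fin N → Fin N → (Fin N → ℂ) → ℝ := fun i j x =>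
    if i < j then statC α N ^ 2 / lam ^ 2 * (pairWeight lam (x i) (x j) * ‖u x‖ ^ 2) else 0
  let Ψ : Fin N → Fin N → (Fin N → ℂ) → ℝ := fun i j x =>
    if i < j then ‖covDeriv α u i 1 x - covDeriv α u j 1 x‖ ^ 2 +
      ‖covDeriv α u i Complex.I x - covDeriv α u j Complex.I x‖ ^ 2 else 0
  have hΦm : ∀ i j, Measurable (Φ i j) := by
    intro i j
    have := hw i j
    by_cases h : i < j
    · simp only [Φ, h, if_true]
      fun_prop
    · simp only [Φ, h, if_false]
      exact measurable_const
  have hΨm : ∀ i j, Measurable (Ψ i j) := by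
    intro i j
    by_cases h : i < j
    · simp only [Ψ, h, if_true]
      fun_prop
    · simp only [Ψ, h, if_false]
      exact measurable_const
  have hΨ0 : ∀ i j x, 0 ≤ Ψ i j x := by
    intro i j x
    simp only [Ψ]
    split_ifs <;> positivity
  have hpair : ∀ i j, ∫⁻ x in Set.univ.pi fun _ : Fin N => Metric.ball (0 : ℂ) lam,
      ENNReal.ofReal (Φ i j x) ≤ ∫⁻ x in Set.univ.pi fun _ : Fin N => Metric.ball (0 : ℂ) lam,
      ENNReal.ofReal (Ψ i j x) := by
    intro i j
    by_cases h : i < j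
    · simp only [Φ, Ψ, h, if_true]
      exact pair_hardy α hlam hu1 hu.symmetric h.ne
    · simp [Φ, h]
  have hΨsum : ∀ x, (N : ℝ)⁻¹ * ∑ i, ∑ j, Ψ i j x ≤ ∑ j, covSq α u j x := by
    intro x
    have h1 := sum_sum_lt_norm_sub_sq_le fun j => covDeriv α u j 1 x
    have h2 := sum_sum_lt_norm_sub_sq_le fun j => covDeriv α u j Complex.I x
    rw [inv_mul_le_iff₀ hN0]
    simp only [covSq_eq, Finset.sum_add_distrib, mul_add]
    refine le_trans (le_of_eq ?_) (add_le_add h1 h2)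
    simp only [← Finset.sum_add_distrib]
    refine Finset.sum_congr rfl fun i _ => Finset.sum_congr rfl fun j _ => ?_
    simp only [Ψ]
    split_ifs <;> simp
  have hNinv : (0 : ℝ) ≤ (N : ℝ)⁻¹ := by positivity
  rw [← lintegral_const_mul' _ _ ENNReal.ofReal_ne_top]
  calc _ ≤ ∫⁻ x in Set.univ.pi fun _ : Fin N => Metric.ball (0 : ℂ) lam,
        ENNReal.ofReal (N : ℝ)⁻¹ * ∑ i, ∑ j, ENNReal.ofReal (Φ i j x) := by
        refine lintegral_mono fun x => ?_
        rw [← ENNReal.ofReal_mul (by positivity)]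
        refine le_trans (le_of_eq ?_) (mul_le_mul_right ((ofReal_sum_le Finset.univ
          fun i => ∑ j, Φ i j x).trans (Finset.sum_le_sum fun i _ => ofReal_sum_le _ _)) _)
        rw [← ENNReal.ofReal_mul hNinv]
        congr 1
        simp only [Finset.mul_sum]
        refine Finset.sum_congr rfl fun i _ => Finset.sum_congr rfl fun j _ => ?_
        simp only [Φ, pairWeight]
        split_ifs
        · field_simp
        · simp
    _ = ENNReal.ofReal (N : ℝ)⁻¹ * ∑ i, ∑ j,
        ∫⁻ x in Set.univ.pi fun _ : Fin N => Metric.ball (0 : ℂ) lam,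
          ENNReal.ofReal (Φ i j x) := by
        rw [lintegral_const_mul' _ _ ENNReal.ofReal_ne_top, lintegral_finsetSum]
        · congr 1
          refine Finset.sum_congr rfl fun i _ => lintegral_finsetSum _ fun j _ => ?_
          exact (hΦm i j).ennreal_ofReal
        · exact fun i _ => Finset.measurable_fun_sum _ fun j _ => (hΦm i j).ennreal_ofReal
    _ ≤ ENNReal.ofReal (N : ℝ)⁻¹ * ∑ i, ∑ j,
        ∫⁻ x in Set.univ.pi fun _ : Fin N => Metric.ball (0 : ℂ) lam,
          ENNReal.ofReal (Ψ i j x) :=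
        mul_le_mul_right (Finset.sum_le_sum fun i _ => Finset.sum_le_sum fun j _ => hpair i j) _
    _ = ∫⁻ x in Set.univ.pi fun _ : Fin N => Metric.ball (0 : ℂ) lam,
        ENNReal.ofReal (N : ℝ)⁻¹ * ∑ i, ∑ j, ENNReal.ofReal (Ψ i j x) := by
        rw [lintegral_const_mul' _ _ ENNReal.ofReal_ne_top, lintegral_finsetSum]
        · congr 1
          refine Finset.sum_congr rfl fun i _ => (lintegral_finsetSum _ fun j _ => ?_).symm
          exact (hΨm i j).ennreal_ofReal
        · exact fun i _ => Finset.measurable_fun_sum _ fun j _ => (hΨm i j).ennreal_ofReal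
    _ ≤ _ := by
        refine lintegral_mono fun x => ?_
        simp only [← ENNReal.ofReal_sum_of_nonneg fun j _ => hΨ0 _ j x]
        rw [← ENNReal.ofReal_sum_of_nonneg
          fun i _ => Finset.sum_nonneg fun j _ => hΨ0 i j x, ← ENNReal.ofReal_mul hNinv]
        exact ENNReal.ofReal_le_ofReal (hΨsum x)

end
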